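/- arXiv:2409.17006 — 2 statements merged into one kernel-verified Lean document; each statement's English description precedes it below -/
import Mathlib

section
/- Let d ≥ 1 and k = d+1, let ω ∈ 𝒢_{k,ℓ} with ℓ ≥ 2, and let α ∈ ℝ^d. Suppose φ : [1,∞) → [1,∞) is non-decreasing, ‖m·α‖ < 1/(H(m)·φ(H(m))) holds for infinitely many m ∈ ℤ^d, and L : [φ(1),∞) → [1,∞) satisfies L(x)·φ(L(x)) = x for all x ≥ φ(1). Then there is a constant c > 0 such that for every M there exists an integer N ≥ max{M, φ(1)} and a test box 𝔅 = (γ;ρ) with |D_ω(𝔅;N)| ≥ c·φ(L(N)). -/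
open scoped BigOperators

/-- The Fourier transform `∫ w(x) e^{-2πiξx} dx` of a real weight function. -/
noncomputable def fhat (w : ℝ → ℝ) (ξ : ℝ) : ℂ :=
  ∫ x : ℝ, (w x : ℂ) * Complex.exp (-(2 * Real.pi * Complex.I * ξ * x))

/-- The class 𝒢_{k,ℓ} of good weight tuples. -/
def GoodWeights (k ℓ : ℕ) (w : Fin k → ℝ → ℝ) : Prop :=
  ∀ i : Fin k,
    (∀ x, 0 ≤ w i x) ∧
    (Function.support (w i) ⊆ Set.Icc (-2 : ℝ) 2) ∧
    ContDiff ℝ ℓ (w i) ∧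
    (∀ ξ : ℝ, (fhat (w i) ξ).im = 0 ∧ 0 ≤ (fhat (w i) ξ).re) ∧
    0 < (fhat (w i) 0).re

/-- Multiplicative height `H(m) = ∏ max(1,|mᵢ|)`. -/
noncomputable def Hmul {d : ℕ} (m : Fin d → ℝ) : ℝ := ∏ i, max 1 |m i|

/-- Distance from `x` to the nearest integer. -/
noncomputable def distInt (x : ℝ) : ℝ := |x - (round x : ℝ)|

/-- The constant 𝔠(ω) = ω̂₁(0)⋯ω̂_k(0). -/
noncomputable def smoothC {k : ℕ} (w : Fin k → ℝ → ℝ) : ℝ := ∏ i, (fhat (w i) 0).re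

/-- Smooth discrepancy of the Kronecker sequence of α in the box (γ; ρ) at scale N. -/
noncomputable def Dbox (d : ℕ) (w : Fin (d+1) → ℝ → ℝ) (α γ ρ : Fin d → ℝ) (N : ℝ) : ℝ :=
  (∑' p : (Fin d → ℤ) × ℤ,
      w (Fin.last d) ((p.2 : ℝ) / N) *
        ∏ i : Fin d, w i.castSucc (((p.1 i : ℝ) + (p.2 : ℝ) * α i - γ i) / ρ i))
    - smoothC w * ((∏ i, ρ i) * N)

/-- The point of the lattice `A ℤ^k` indexed by the integer vector `a`. -/
noncomputable def latPt {k : ℕ} (A : Matrix (Fin k) (Fin k) ℝ) (a : Fin k → ℤ) : Fin k → ℝ :=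
  A.mulVec (fun i => (a i : ℝ))

/-- The point of the dual lattice `(A⁻¹)ᵀ ℤ^k` indexed by the integer vector `a`. -/
noncomputable def dualPt {k : ℕ} (A : Matrix (Fin k) (Fin k) ℝ) (a : Fin k → ℤ) : Fin k → ℝ :=
  (A⁻¹).transpose.mulVec (fun i => (a i : ℝ))

/-- Smooth lattice discrepancy of the lattice `A ℤ^{d+1}` in the box (γ; ρ) at scale N. -/
noncomputable def DboxLat (d : ℕ) (A : Matrix (Fin (d+1)) (Fin (d+1)) ℝ)
    (w : Fin (d+1) → ℝ → ℝ) (γ ρ : Fin d → ℝ) (N : ℝ) : ℝ :=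
  (∑' a : Fin (d+1) → ℤ,
      w (Fin.last d) (latPt A a (Fin.last d) / N) *
        ∏ i : Fin d, w i.castSucc ((latPt A a i.castSucc - γ i) / ρ i))
    - smoothC w * ((∏ i, ρ i) * N)

/-- Side-length vector of a test box: each ρᵢ ∈ (0, 1/2). -/
def IsBox {d : ℕ} (ρ : Fin d → ℝ) : Prop := ∀ i, 0 < ρ i ∧ ρ i < 1/2

/-- Every nonzero dual lattice point (λ, λ_k) satisfies H(λ)·|λ_k| > 1/φ(H(λ)). -/
def DualBad (d : ℕ) (A : Matrix (Fin (d+1)) (Fin (d+1)) ℝ) (φ : ℝ → ℝ) : Prop :=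
  ∀ a : Fin (d+1) → ℤ, dualPt A a ≠ 0 →
    Hmul (fun i : Fin d => dualPt A a i.castSucc) * |dualPt A a (Fin.last d)| >
      1 / φ (Hmul (fun i : Fin d => dualPt A a i.castSucc))


open scoped FourierTransform in
lemma poisson_aux {g : ℝ → ℂ} (hg : ContDiff ℝ 2 g) (hc : HasCompactSupport g) :
    HasSum (fun j : ℤ => 𝓕 g (j : ℝ)) (∑' n : ℤ, g n) := by
  have hit : ∀ n : ℕ, HasCompactSupport (iteratedDeriv n g) := by
    intro n
    induction n with
    | zero => simpa using hc
    | succ k ih => rw [iteratedDeriv_succ]; exact ih.deriv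
  have hint : ∀ n : ℕ, ((n : ℕ∞) ≤ (2 : ℕ∞)) → MeasureTheory.Integrable (iteratedDeriv n g) := by
    intro n hn
    refine Continuous.integrable_of_hasCompactSupport ?_ (hit n)
    exact hg.continuous_iteratedDeriv n (by exact_mod_cast hn)
  have hF := Real.fourier_iteratedDeriv (N := 2) (n := 2) (f := g) (by exact_mod_cast hg) hint
    (by norm_num)
  set C : ℝ := ∫ x, ‖iteratedDeriv 2 g x‖ with hC
  have hbd : ∀ x : ℝ, x ≠ 0 → ‖𝓕 g x‖ ≤ C * ‖|x| ^ (-2 : ℝ)‖ := by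
    intro x hx
    have h1 : ‖𝓕 (iteratedDeriv 2 g) x‖ ≤ C :=
      VectorFourier.norm_fourierIntegral_le_integral_norm _ _ _ _ _
    rw [hF] at h1
    have hx' : 0 < |x| := abs_pos.mpr hx
    have h2 : ‖(2 * Real.pi * Complex.I * x : ℂ) ^ 2 • 𝓕 g x‖
        = (2 * Real.pi) ^ 2 * |x| ^ 2 * ‖𝓕 g x‖ := by
      rw [norm_smul, norm_pow, norm_mul, norm_mul, norm_mul]
      simp only [Complex.norm_real, Complex.norm_I, Complex.norm_ofNat, Real.norm_eq_abs, abs_of_pos Real.pi_pos]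
      ring
    simp only [] at h1
    rw [h2] at h1
    have h3 : |x| ^ (-2 : ℝ) = (|x| ^ 2)⁻¹ := by
      rw [Real.rpow_neg hx'.le]; norm_num
    rw [h3, Real.norm_of_nonneg (by positivity), ← div_eq_mul_inv, le_div_iff₀ (by positivity)]
    have hp : (1 : ℝ) ≤ (2 * Real.pi) ^ 2 := by
      nlinarith [Real.pi_gt_three]
    calc ‖𝓕 g x‖ * |x| ^ 2 ≤ (2 * Real.pi) ^ 2 * (‖𝓕 g x‖ * |x| ^ 2) :=
          le_mul_of_one_le_left (by positivity) hp
      _ ≤ C := by linarith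
  have hO : (𝓕 g) =O[Filter.cocompact ℝ] (fun x : ℝ => |x| ^ (-2 : ℝ)) := by
    refine Asymptotics.IsBigO.of_bound C ?_
    filter_upwards [(isCompact_singleton (x := (0 : ℝ))).compl_mem_cocompact] with x hx
    exact hbd x (by simpa using hx)
  have hO2 : g =O[Filter.cocompact ℝ] (fun x : ℝ => |x| ^ (-2 : ℝ)) := by
    refine Asymptotics.IsBigO.of_bound 0 ?_
    filter_upwards [hc.isCompact.compl_mem_cocompact] with x hx
    have : g x = 0 := image_eq_zero_of_notMem_tsupport hx
    simp [this]
  have hs : Summable fun n : ℤ => 𝓕 g (n : ℝ) :=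
    summable_of_isBigO (Real.summable_abs_int_rpow (b := 2) (by norm_num))
      (hO.comp_tendsto Int.tendsto_coe_cofinite)
  have h := Real.tsum_eq_tsum_fourier_of_rpow_decay_of_summable hg.continuous (b := 2)
    (by norm_num) hO2 hs 0
  simp at h
  rw [h]
  exact hs.hasSum

/-- `e(x) = exp(2πix)`. -/
noncomputable def ee (x : ℝ) : ℂ := Complex.exp (((2 * Real.pi * x : ℝ) : ℂ) * Complex.I)

lemma ee_add (x y : ℝ) : ee (x + y) = ee x * ee y := by
  unfold ee; rw [← Complex.exp_add]; congr 1; push_cast; ring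

lemma ee_zero : ee 0 = 1 := by simp [ee]

open scoped FourierTransform in
lemma fourier_shift (w : ℝ → ℝ) (ρ t θ ξ : ℝ) (hρ : 0 < ρ) :
    𝓕 (fun x : ℝ => (w ((x + t) / ρ) : ℂ) * ee (θ * (x + t))) ξ
      = ρ * ee (ξ * t) * fhat w (ρ * (ξ - θ)) := by
  rw [Real.fourier_real_eq_integral_exp_smul]
  have h1 : ∀ v : ℝ, Complex.exp (↑(-2 * Real.pi * v * ξ) * Complex.I) •
      ((w ((v + t) / ρ) : ℂ) * ee (θ * (v + t)))
      = (fun u : ℝ => (w (u / ρ) : ℂ) * ee (θ * u - (u - t) * ξ)) (v + t) := by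
    intro v
    have : Complex.exp (↑(-2 * Real.pi * v * ξ) * Complex.I) = ee (- v * ξ) := by
      unfold ee; congr 2; push_cast; ring
    rw [this, smul_eq_mul, mul_left_comm, ← ee_add]
    simp only []
    congr 2; ring
  simp_rw [h1]
  rw [MeasureTheory.integral_add_right_eq_self
    (fun u : ℝ => (w (u / ρ) : ℂ) * ee (θ * u - (u - t) * ξ))]
  have h2 : ∀ u : ℝ, (w (u / ρ) : ℂ) * ee (θ * u - (u - t) * ξ)
      = (fun y : ℝ => (w y : ℂ) * ee (θ * (ρ * y) - (ρ * y - t) * ξ)) (u / ρ) := by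
    intro u
    simp only []
    rw [mul_div_cancel₀ _ hρ.ne']
  simp_rw [h2]
  rw [MeasureTheory.Measure.integral_comp_div
    (fun y : ℝ => (w y : ℂ) * ee (θ * (ρ * y) - (ρ * y - t) * ξ)), abs_of_pos hρ]
  unfold fhat
  rw [Complex.real_smul, mul_assoc, ← MeasureTheory.integral_const_mul (ee (ξ * t))]
  congr 1
  refine MeasureTheory.integral_congr_ae (Filter.Eventually.of_forall fun y => ?_)
  simp only []
  rw [mul_left_comm (ee (ξ * t))]
  congr 1
  have : Complex.exp (-(2 * Real.pi * Complex.I * ((ρ * (ξ - θ) : ℝ) : ℂ) * y))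
      = ee (-(ρ * (ξ - θ) * y)) := by
    unfold ee; congr 1; push_cast; ring
  rw [this, ← ee_add]
  congr 1; ring

lemma ee_contDiff : ContDiff ℝ 2 ee := by
  unfold ee
  refine Complex.contDiff_exp.comp ?_ |>.of_le le_top
  exact (Complex.ofRealCLM.contDiff.comp (contDiff_const.mul contDiff_id)).mul contDiff_const

lemma hcs_of_supp {w : ℝ → ℝ} (hs : Function.support w ⊆ Set.Icc (-2 : ℝ) 2) :
    HasCompactSupport w :=
  HasCompactSupport.of_support_subset_isCompact isCompact_Icc hs

lemma poisson_w {w : ℝ → ℝ} (hs : Function.support w ⊆ Set.Icc (-2 : ℝ) 2)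
    (hw : ContDiff ℝ 2 w) (ρ t θ : ℝ) (hρ : 0 < ρ) :
    HasSum (fun j : ℤ => (ρ : ℂ) * ee (j * t) * fhat w (ρ * (j - θ)))
      (∑' n : ℤ, (w ((n + t) / ρ) : ℂ) * ee (θ * (n + t))) := by
  have h := poisson_aux (g := fun x : ℝ => (w ((x + t) / ρ) : ℂ) * ee (θ * (x + t))) ?_ ?_
  · simpa only [fourier_shift w ρ t θ _ hρ] using h
  · refine ContDiff.mul ?_ (ee_contDiff.comp (by fun_prop))
    exact Complex.ofRealCLM.contDiff.comp (hw.comp (by fun_prop))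
  · refine HasCompactSupport.mul_right ?_
    refine HasCompactSupport.of_support_subset_isCompact
      (isCompact_Icc (a := -2 * ρ - t) (b := 2 * ρ - t)) ?_
    intro x hx
    have : w ((x + t) / ρ) ≠ 0 := by
      intro h0; simp [h0] at hx
    have h2 := hs this
    rw [Set.mem_Icc, le_div_iff₀ hρ, div_le_iff₀ hρ] at h2
    constructor <;> linarith [h2.1, h2.2]

open scoped FourierTransform in
lemma fhat_continuous {w : ℝ → ℝ} (hs : Function.support w ⊆ Set.Icc (-2 : ℝ) 2)
    (hw : Continuous w) : Continuous (fhat w) := by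
  have hi : MeasureTheory.Integrable (fun x => (w x : ℂ)) :=
    (hw.integrable_of_hasCompactSupport (hcs_of_supp hs)).ofReal
  have : fhat w = 𝓕 (fun x => (w x : ℂ)) := by
    ext ξ
    have := fourier_shift w 1 0 0 ξ one_pos
    simpa [ee_zero] using this.symm
  rw [this]
  exact VectorFourier.fourierIntegral_continuous Real.continuous_fourierChar
    (by simpa using continuous_inner (𝕜 := ℝ) (E := ℝ)) hi

lemma zero_of_large {w : ℝ → ℝ} (hs : Function.support w ⊆ Set.Icc (-2 : ℝ) 2)
    {ρ t : ℝ} (hρ : 0 < ρ) {B : ℤ} (hB : 2 * ρ + |t| ≤ B) {n : ℤ}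
    (hn : n ∉ Finset.Icc (-B) B) : w ((n + t) / ρ) = 0 := by
  by_contra h
  have h2 := hs h
  rw [Set.mem_Icc, le_div_iff₀ hρ, div_le_iff₀ hρ] at h2
  apply hn
  have h3 := neg_abs_le t
  have h4 := le_abs_self t
  rw [Finset.mem_Icc]
  constructor
  · have : (-(B : ℝ)) ≤ n := by linarith [h2.1]
    exact_mod_cast this
  · have : (n : ℝ) ≤ B := by linarith [h2.2]
    exact_mod_cast this

lemma T_lower {w : ℝ → ℝ} (hs : Function.support w ⊆ Set.Icc (-2 : ℝ) 2)
    (hw : ContDiff ℝ 2 w) (hf : ∀ ξ : ℝ, (fhat w ξ).im = 0 ∧ 0 ≤ (fhat w ξ).re)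
    (N θ : ℝ) (hN : 0 < N) (B : ℤ) (hB : 2 * N ≤ B) (j : ℤ) :
    N * (fhat w (N * (j - θ))).re ≤
      (∑ n ∈ Finset.Icc (-B) B, (w (n / N) : ℂ) * ee (θ * n)).re := by
  have h := poisson_w hs hw N 0 θ hN
  rw [tsum_eq_sum (s := Finset.Icc (-B) B)] at h
  · simp only [mul_zero, ee_zero, mul_one, add_zero] at h
    have h2 := Complex.hasSum_re h
    simp only [Complex.re_ofReal_mul] at h2
    exact le_hasSum h2 j (fun i _ => mul_nonneg hN.le (hf _).2)
  · intro n hn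
    rw [zero_of_large hs hN (by simpa using hB) hn]
    simp

lemma Q_tendsto {w : ℝ → ℝ} (hs : Function.support w ⊆ Set.Icc (-2 : ℝ) 2)
    (hw : ContDiff ℝ 2 w) (hf : ∀ ξ : ℝ, (fhat w ξ).im = 0 ∧ 0 ≤ (fhat w ξ).re)
    (ρ t : ℝ) (hρ : 0 < ρ) (B : ℤ) (hB : 2 * ρ + |t| ≤ B) :
    Filter.Tendsto (fun K : ℕ => ∑ m ∈ Finset.Icc (-(K : ℤ)) K,
        ((ρ * (fhat w (ρ * m)).re : ℝ) : ℂ) * ee (m * t)) Filter.atTop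
      (nhds ((∑ a ∈ Finset.Icc (-B) B, w ((a + t) / ρ) : ℝ) : ℂ)) := by
  have h := poisson_w hs hw ρ t 0 hρ
  rw [tsum_eq_sum (s := Finset.Icc (-B) B)] at h
  · simp only [zero_mul, ee_zero, mul_one, sub_zero] at h
    have h2 := h.comp (Finset.tendsto_Icc_neg (R := ℤ))
    push_cast
    refine h2.congr ?_
    intro K
    simp only [Function.comp]
    refine Finset.sum_congr rfl fun m _ => ?_
    have : fhat w (ρ * m) = ((fhat w (ρ * m)).re : ℂ) := by
      apply Complex.ext <;> simp [(hf _).1]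
    rw [this]
    simp only [Complex.ofReal_re]
    ring
  · intro n hn
    rw [zero_of_large hs hρ hB hn]
    simp

lemma ee_sum {ι : Type*} (s : Finset ι) (f : ι → ℝ) : ee (∑ i ∈ s, f i) = ∏ i ∈ s, ee (f i) := by
  classical
  induction s using Finset.induction_on with
  | empty => simp [ee_zero]
  | insert a s ha ih => rw [Finset.sum_insert ha, Finset.prod_insert ha, ee_add, ih]

lemma Dbox_lower (d ℓ : ℕ) (hℓ : 2 ≤ ℓ)
    (w : Fin (d+1) → ℝ → ℝ) (hw : GoodWeights (d+1) ℓ w)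
    (α ρ : Fin d → ℝ) (hρ : ∀ i, 0 < ρ i) (N : ℝ) (hN : 0 < N)
    (m : Fin d → ℤ) (hm : m ≠ 0) (j : ℤ) :
    (∏ i, (ρ i * (fhat (w i.castSucc) (ρ i * m i)).re)) *
      (N * (fhat (w (Fin.last d)) (N * (j - ∑ i, (m i : ℝ) * α i))).re)
      ≤ Dbox d w α 0 ρ N := by
  classical
  have hs := fun i => (hw i).2.1
  have hC2 : ∀ i, ContDiff ℝ 2 (w i) := fun i => (hw i).2.2.1.of_le (by exact_mod_cast hℓ)
  have hf := fun i => (hw i).2.2.2.1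
  obtain ⟨B, hB⟩ := exists_int_ge (2 * N)
  have hB0 : (0 : ℝ) ≤ B := by linarith
  obtain ⟨A, hA⟩ := exists_int_ge (∑ i, (2 * ρ i + B * |α i|))
  have hA' : ∀ n ∈ Finset.Icc (-B) B, ∀ i, 2 * ρ i + |(n : ℝ) * α i| ≤ A := by
    intro n hn i
    refine le_trans ?_ hA
    refine le_trans ?_ (Finset.single_le_sum (f := fun i => 2 * ρ i + B * |α i|) ?_
      (Finset.mem_univ i))
    · rw [abs_mul]
      have : |(n : ℝ)| ≤ B := by
        rw [Finset.mem_Icc] at hn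
        rw [abs_le]; exact_mod_cast hn
      gcongr
    · intro i _
      have := hρ i
      positivity
  -- the sum as a finite sum
  have hfin : (∑' p : (Fin d → ℤ) × ℤ,
      w (Fin.last d) ((p.2 : ℝ) / N) *
        ∏ i : Fin d, w i.castSucc (((p.1 i : ℝ) + (p.2 : ℝ) * α i - (0 : Fin d → ℝ) i) / ρ i))
      = ∑ n ∈ Finset.Icc (-B) B, w (Fin.last d) (n / N) *
        ∏ i : Fin d, ∑ a ∈ Finset.Icc (-A) A, w i.castSucc ((a + n * α i) / ρ i) := by
    rw [tsum_eq_sum (s := Fintype.piFinset (fun _ : Fin d => Finset.Icc (-A) A) ×ˢ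
      Finset.Icc (-B) B)]
    · rw [Finset.sum_product_right]
      refine Finset.sum_congr rfl fun n _ => ?_
      rw [Finset.prod_univ_sum, Finset.mul_sum]
      simp
    · rintro ⟨a, n⟩ hp
      simp only [Pi.zero_apply, sub_zero]
      by_cases hn : n ∈ Finset.Icc (-B) B
      · have : ∃ i, a i ∉ Finset.Icc (-A) A := by
          by_contra hcon
          push Not at hcon
          exact hp (Finset.mem_product.mpr ⟨Fintype.mem_piFinset.mpr hcon, hn⟩)
        obtain ⟨i, hi⟩ := this
        rw [Finset.prod_eq_zero (Finset.mem_univ i), mul_zero]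
        exact zero_of_large (hs _) (hρ i) (hA' n hn i) hi
      · have := zero_of_large (t := 0) (hs (Fin.last d)) hN (by simpa using hB) hn
        rw [add_zero] at this
        rw [this, zero_mul]
  set Cm : (Fin d → ℤ) → ℝ := fun m => ∏ i, (ρ i * (fhat (w i.castSucc) (ρ i * m i)).re) with hCm
  set T : ℝ → ℂ := fun θ => ∑ n ∈ Finset.Icc (-B) B, (w (Fin.last d) (n / N) : ℂ) * ee (θ * n)
    with hT
  have hCm0 : ∀ m, 0 ≤ Cm m := fun m =>
    Finset.prod_nonneg fun i _ => mul_nonneg (hρ i).le (hf _ _).2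
  have hTl : ∀ θ (j : ℤ), N * (fhat (w (Fin.last d)) (N * (j - θ))).re ≤ (T θ).re := fun θ j =>
    T_lower (hs _) (hC2 _) (hf _) N θ hN B hB j
  have hT0 : ∀ θ, 0 ≤ (T θ).re := fun θ =>
    le_trans (mul_nonneg hN.le (hf _ _).2) (hTl θ 0)
  have hlim : Filter.Tendsto (fun K : ℕ => ∑ n ∈ Finset.Icc (-B) B, (w (Fin.last d) (n / N) : ℂ) *
      ∏ i : Fin d, ∑ m ∈ Finset.Icc (-(K : ℤ)) K,
        ((ρ i * (fhat (w i.castSucc) (ρ i * m)).re : ℝ) : ℂ) * ee (m * (n * α i))) Filter.atTop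
      (nhds ((∑ n ∈ Finset.Icc (-B) B, w (Fin.last d) (n / N) *
        ∏ i : Fin d, ∑ a ∈ Finset.Icc (-A) A, w i.castSucc ((a + n * α i) / ρ i) : ℝ) : ℂ)) := by
    rw [Complex.ofReal_sum]
    refine tendsto_finsetSum _ fun n hn => ?_
    rw [Complex.ofReal_mul, Complex.ofReal_prod]
    refine Filter.Tendsto.const_mul _ (tendsto_finsetProd _ fun i _ => ?_)
    exact Q_tendsto (hs _) (hC2 _) (hf _) (ρ i) _ (hρ i) A (hA' n hn i)
  have hSK : ∀ K : ℕ, ∑ n ∈ Finset.Icc (-B) B, (w (Fin.last d) (n / N) : ℂ) *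
      ∏ i : Fin d, ∑ m ∈ Finset.Icc (-(K : ℤ)) K,
        ((ρ i * (fhat (w i.castSucc) (ρ i * m)).re : ℝ) : ℂ) * ee (m * (n * α i))
      = ∑ m ∈ Fintype.piFinset (fun _ : Fin d => Finset.Icc (-(K : ℤ)) K),
        (Cm m : ℂ) * T (∑ i, (m i : ℝ) * α i) := by
    intro K
    simp_rw [Finset.prod_univ_sum, hT, Finset.mul_sum]
    rw [Finset.sum_comm]
    refine Finset.sum_congr rfl fun m _ => Finset.sum_congr rfl fun n _ => ?_
    rw [Finset.prod_mul_distrib, ← ee_sum, hCm, Complex.ofReal_prod, mul_left_comm]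
    congr 3
    rw [Finset.sum_mul]
    refine Finset.sum_congr rfl fun i _ => ?_
    ring
  simp_rw [hSK] at hlim
  have hre := (Complex.continuous_re.tendsto _).comp hlim
  rw [Complex.ofReal_re] at hre
  have hge : Cm 0 * (T 0).re + Cm m * (T (∑ i, (m i : ℝ) * α i)).re ≤
      ∑ n ∈ Finset.Icc (-B) B, w (Fin.last d) (n / N) *
        ∏ i : Fin d, ∑ a ∈ Finset.Icc (-A) A, w i.castSucc ((a + n * α i) / ρ i) := by
    refine ge_of_tendsto hre ?_
    filter_upwards [Filter.eventually_ge_atTop (∑ i, (m i).natAbs)] with K hK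
    simp only [Function.comp, Complex.re_sum, Complex.re_ofReal_mul]
    have hsub : ({0, m} : Finset (Fin d → ℤ)) ⊆
        Fintype.piFinset (fun _ : Fin d => Finset.Icc (-(K : ℤ)) K) := by
      intro x hx
      rw [Fintype.mem_piFinset]
      intro i
      rw [Finset.mem_insert, Finset.mem_singleton] at hx
      rw [Finset.mem_Icc]
      rcases hx with rfl | rfl
      · simp
      · have := Finset.single_le_sum (f := fun i => (x i).natAbs) (fun _ _ => Nat.zero_le _)
          (Finset.mem_univ i)
        omega
    refine le_trans (le_of_eq ?_) (Finset.sum_le_sum_of_subset_of_nonneg hsub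
      (fun x _ _ => mul_nonneg (hCm0 x) (hT0 _)))
    rw [Finset.sum_pair hm.symm]
    simp
  unfold Dbox
  rw [hfin]
  have h0 : smoothC w * ((∏ i, ρ i) * N) ≤ Cm 0 * (T 0).re := by
    have h1 := hTl 0 0
    have h2 := mul_le_mul_of_nonneg_left h1 (hCm0 0)
    refine le_trans (le_of_eq ?_) h2
    simp only [hCm, smoothC, Fin.prod_univ_castSucc, Finset.prod_mul_distrib]
    simp
    ring
  have h1 := mul_le_mul_of_nonneg_left (hTl (∑ i, (m i : ℝ) * α i) j) (hCm0 m)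
  linarith

lemma exists_delta {w : ℝ → ℝ} (hs : Function.support w ⊆ Set.Icc (-2 : ℝ) 2)
    (hw : Continuous w) (h0 : 0 < (fhat w 0).re) :
    ∃ δ : ℝ, 0 < δ ∧ ∀ ξ, |ξ| ≤ δ → (fhat w 0).re / 2 ≤ (fhat w ξ).re := by
  have hc := (Complex.continuous_re.comp (fhat_continuous hs hw)).tendsto 0
  have := hc.eventually_const_lt (show (fhat w 0).re / 2 < (Complex.re ∘ fhat w) 0 by
    simp only [Function.comp]; linarith)
  obtain ⟨ε, hε, h⟩ := Metric.eventually_nhds_iff.mp this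
  refine ⟨ε / 2, by positivity, fun ξ hξ => (h ?_).le⟩
  rw [Real.dist_eq, sub_zero]
  linarith

lemma Hmul_one_le {d : ℕ} (m : Fin d → ℝ) : 1 ≤ Hmul m := by
  unfold Hmul
  calc (1 : ℝ) = ∏ _i : Fin d, 1 := by simp
    _ ≤ _ := Finset.prod_le_prod (by simp) (fun i _ => le_max_left _ _)

lemma abs_le_Hmul {d : ℕ} (m : Fin d → ℝ) (i : Fin d) : |m i| ≤ Hmul m := by
  classical
  unfold Hmul
  rw [← Finset.mul_prod_erase _ _ (Finset.mem_univ i)]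
  have : (1 : ℝ) ≤ ∏ x ∈ Finset.univ.erase i, max 1 |m x| := by
    calc (1 : ℝ) = ∏ _x ∈ Finset.univ.erase i, 1 := by simp
      _ ≤ _ := Finset.prod_le_prod (by simp) (fun i _ => le_max_left _ _)
  calc |m i| ≤ max 1 |m i| := le_max_right _ _
    _ ≤ _ := le_mul_of_one_le_right (by positivity) this

lemma finite_Hmul {d : ℕ} (X : ℝ) : {m : Fin d → ℤ | Hmul (fun i => (m i : ℝ)) ≤ X}.Finite := by
  obtain ⟨B, hB⟩ := exists_int_ge X
  refine (Set.finite_Icc (fun _ : Fin d => -B) (fun _ => B)).subset ?_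
  intro m hm
  have h : ∀ i, |(m i : ℝ)| ≤ B := fun i =>
    ((abs_le_Hmul (fun i => (m i : ℝ)) i).trans hm).trans hB
  constructor
  · intro i
    have := (abs_le.mp (h i)).1
    exact_mod_cast this
  · intro i
    have := (abs_le.mp (h i)).2
    exact_mod_cast this
/-- Theorem: smooth discrepancy lower bound, Kronecker case. -/
theorem smooth_discrepancy_lower_kronecker
    (d : ℕ) (hd : 1 ≤ d) (ℓ : ℕ) (hℓ : 2 ≤ ℓ)
    (w : Fin (d+1) → ℝ → ℝ) (hw : GoodWeights (d+1) ℓ w)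
    (α : Fin d → ℝ) (φ L : ℝ → ℝ)
    (hφmap : ∀ x, 1 ≤ x → 1 ≤ φ x)
    (hφmono : ∀ x y, 1 ≤ x → x ≤ y → φ x ≤ φ y)
    (hinf : {m : Fin d → ℤ |
      distInt (∑ i, (m i : ℝ) * α i) <
        1 / (Hmul (fun i => (m i : ℝ)) * φ (Hmul (fun i => (m i : ℝ))))}.Infinite)
    (hLmap : ∀ x, φ 1 ≤ x → 1 ≤ L x)
    (hLdef : ∀ x, φ 1 ≤ x → L x * φ (L x) = x) :
    ∃ c : ℝ, 0 < c ∧ ∀ M : ℝ, ∃ N : ℕ, M ≤ (N : ℝ) ∧ φ 1 ≤ (N : ℝ) ∧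
      ∃ γ ρ : Fin d → ℝ, IsBox ρ ∧ c * φ (L N) ≤ |Dbox d w α γ ρ N| := by
  have hC : ∀ i, Continuous (w i) := fun i => (hw i).2.2.1.continuous
  choose δs hδpos hδlow using fun i => exists_delta (hw i).2.1 (hC i) (hw i).2.2.2.2
  obtain ⟨δ, hδ, hδ4, hδle⟩ : ∃ δ : ℝ, 0 < δ ∧ δ < 1/2 ∧ ∀ i, δ ≤ δs i := by
    have hne : (Finset.univ : Finset (Fin (d+1))).Nonempty := Finset.univ_nonempty
    refine ⟨min (1/4) (Finset.univ.inf' hne δs), ?_, ?_, ?_⟩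
    · refine lt_min (by norm_num) ?_
      rw [Finset.lt_inf'_iff]
      exact fun i _ => hδpos i
    · exact lt_of_le_of_lt (min_le_left _ _) (by norm_num)
    · exact fun i => (min_le_right _ _).trans (Finset.inf'_le _ (Finset.mem_univ i))
  set P : ℝ := ∏ i : Fin (d+1), ((fhat (w i) 0).re / 2) with hP
  have hP0 : 0 < P := Finset.prod_pos fun i _ => half_pos (hw i).2.2.2.2
  refine ⟨δ ^ (d+1) / 2 * P, by positivity, fun M => ?_⟩
  -- choose `m` of large height
  obtain ⟨m, hm, hmX⟩ := (hinf.sdiff (finite_Hmul (d := d) (max 1 (2 * (|M| + 1) / δ)))).nonempty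
  set H : ℝ := Hmul (fun i => (m i : ℝ)) with hH
  have hmX' : max 1 (2 * (|M| + 1) / δ) < H := not_le.mp hmX
  have hH1 : 1 < H := (le_max_left _ _).trans_lt hmX'
  have hHM : 2 * (|M| + 1) < H * δ := by
    have := (le_max_right _ _).trans_lt hmX'
    rwa [div_lt_iff₀ hδ] at this
  have hm0 : m ≠ 0 := by
    rintro rfl
    simp [hH, Hmul] at hH1
  have hφH : 1 ≤ φ H := hφmap H hH1.le
  have hφ1 : 1 ≤ φ 1 := hφmap 1 le_rfl
  have hφ1H : φ 1 ≤ φ H := hφmono 1 H le_rfl hH1.le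
  set N : ℕ := ⌊δ * (H * φ H)⌋₊ with hN
  have hNle : (N : ℝ) ≤ δ * (H * φ H) := Nat.floor_le (by positivity)
  have hM0 := abs_nonneg M
  have hbig : 2 * (|M| + 1) * φ H ≤ δ * (H * φ H) := by
    calc 2 * (|M| + 1) * φ H ≤ (H * δ) * φ H := by gcongr
      _ = _ := by ring
  have hNlt : δ * (H * φ H) < N + 1 := Nat.lt_floor_add_one _
  have hMφ : |M| ≤ |M| * φ H := le_mul_of_one_le_right hM0 hφH
  have hNge : δ * (H * φ H) / 2 ≤ N := by nlinarith
  have hNM : |M| + φ H ≤ N := by nlinarith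
  have hNφ : φ 1 ≤ (N : ℝ) := by linarith
  have hN0 : (0 : ℝ) < N := by linarith
  refine ⟨N, by linarith [le_abs_self M], hNφ, 0, fun i => δ / max 1 |(m i : ℝ)|, ?_, ?_⟩
  · intro i
    have h1 : (1 : ℝ) ≤ max 1 |(m i : ℝ)| := le_max_left _ _
    exact ⟨by positivity, (div_le_self hδ.le h1).trans_lt hδ4⟩
  -- `φ (L N) ≤ φ H`
  have hL1 := hLmap N hNφ
  have hLH : L N ≤ H := by
    by_contra hcon
    push Not at hcon
    have h1 := hφmono H (L N) hH1.le hcon.le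
    have h2 := hLdef N hNφ
    have h3 : H * φ H < L N * φ (L N) := mul_lt_mul hcon h1 (by linarith) (by linarith)
    have h4 : δ * (H * φ H) ≤ 1 * (H * φ H) :=
      mul_le_mul_of_nonneg_right (by linarith) (by positivity)
    linarith
  have hφL : φ (L N) ≤ φ H := hφmono _ _ hL1 hLH
  have hρ : ∀ i, 0 < δ / max 1 |(m i : ℝ)| := fun i => by positivity
  have hD := Dbox_lower d ℓ hℓ w hw α (fun i => δ / max 1 |(m i : ℝ)|) hρ N hN0 m hm0
    (round (∑ i, (m i : ℝ) * α i))
  refine le_trans ?_ (hD.trans (le_abs_self _))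
  have hlast : (fhat (w (Fin.last d)) 0).re / 2 ≤ (fhat (w (Fin.last d))
      (N * ((round (∑ i, (m i : ℝ) * α i) : ℝ) - ∑ i, (m i : ℝ) * α i))).re := by
    refine hδlow _ _ (le_trans ?_ (hδle _))
    rw [abs_mul, abs_sub_comm, abs_of_pos hN0]
    have hm' : distInt (∑ i, (m i : ℝ) * α i) < 1 / (H * φ H) := hm
    unfold distInt at hm'
    calc _ ≤ (δ * (H * φ H)) * (1 / (H * φ H)) := by gcongr
      _ = δ := by field_simp
  have hprod : δ ^ d / H * ∏ i : Fin d, ((fhat (w i.castSucc) 0).re / 2) ≤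
      ∏ i : Fin d, (δ / max 1 |(m i : ℝ)| *
        (fhat (w i.castSucc) (δ / max 1 |(m i : ℝ)| * m i)).re) := by
    have : δ ^ d / H = ∏ i : Fin d, (δ / max 1 |(m i : ℝ)|) := by
      rw [Finset.prod_div_distrib]; simp [hH, Hmul]
    rw [this, ← Finset.prod_mul_distrib]
    refine Finset.prod_le_prod (fun i _ => ?_) (fun i _ => ?_)
    · exact mul_nonneg (hρ i).le (half_pos (hw _).2.2.2.2).le
    · refine mul_le_mul_of_nonneg_left ?_ (hρ i).le
      refine hδlow _ _ (le_trans ?_ (hδle _))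
      rw [abs_mul, abs_of_pos (hρ i), div_mul_eq_mul_div, div_le_iff₀ (by positivity)]
      exact mul_le_mul_of_nonneg_left (le_max_right _ _) hδ.le
  have hlast0 : 0 < (fhat (w (Fin.last d)) 0).re / 2 := half_pos (hw _).2.2.2.2
  have hcs0 : 0 < ∏ i : Fin d, ((fhat (w i.castSucc) 0).re / 2) :=
    Finset.prod_pos fun i _ => half_pos (hw _).2.2.2.2
  calc δ ^ (d+1) / 2 * P * φ (L N) ≤ δ ^ (d+1) / 2 * P * φ H := by gcongr
    _ = (δ ^ d / H * ∏ i : Fin d, ((fhat (w i.castSucc) 0).re / 2)) *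
        ((δ * (H * φ H) / 2) * ((fhat (w (Fin.last d)) 0).re / 2)) := by
      rw [hP, Fin.prod_univ_castSucc]
      field_simp
      ring
    _ ≤ _ := by
      refine mul_le_mul hprod ?_ (by positivity) (le_trans (by positivity) hprod)
      exact mul_le_mul hNge hlast hlast0.le hN0.le
end

section
/- Let d ≥ 1, k = d+1, let Λ = Aℤ^k be a unimodular lattice in ℝ^k with dual Λ* = (A^{−1})ᵀℤ^k, and let ω ∈ 𝒢_{k,ℓ}. Suppose φ : [1,∞) → [1,∞) is non-decreasing, every nonzero (λ,λ_k) ∈ Λ* (with λ ∈ ℝ^d) satisfies H(λ)·|λ_k| > 1/φ(H(λ)), ξ := limsup_{x→∞} φ(2x)/φ(x) < ∞, and ℓ > 2 + 2·log ξ / log 2. Let L : [φ(1),∞) → [1,∞) satisfy L(x)·φ(L(x)) = x for all x ≥ φ(1). Then there is a constant C > 0 such that for every integer N ≥ φ(1) and every test box 𝔅 = (γ;ρ), one has |D_ω^Λ(𝔅;N)| ≤ C·φ(L(N)). -/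
open scoped BigOperators

open MeasureTheory in
lemma unfold_hasSum {k : ℕ} {E : Type*} [NormedAddCommGroup E] [NormedSpace ℝ E]
    (G : (Fin k → ℝ) → E) (hG : Integrable G) :
    HasSum (fun m : Fin k → ℤ =>
      ∫ x in {x : Fin k → ℝ | ∀ i, x i ∈ Set.Ioc (0:ℝ) (0 + 1)}, G (x + fun i => (m i : ℝ)))
      (∫ x, G x) := by
  let B : (Fin k → ℤ) → Set (Fin k → ℝ) := fun m => {x | ∀ i, x i ∈ Set.Ioc (m i : ℝ) (m i + 1)}
  have hB : ∀ m, MeasurableSet (B m) := fun m => by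
    exact MeasurableSet.univ_pi' (fun i => measurableSet_Ioc)
  have hU : ⋃ m, B m = Set.univ := by
    ext x
    simp only [Set.mem_iUnion, Set.mem_univ, iff_true]
    refine ⟨fun i => ⌈x i⌉ - 1, fun i => ?_⟩
    push_cast
    constructor
    · linarith [Int.ceil_lt_add_one (x i)]
    · linarith [Int.le_ceil (x i)]
  have hd : Pairwise (Function.onFun Disjoint B) := by
    intro m n hmn
    rw [Function.onFun, Set.disjoint_left]
    intro x hx hy
    apply hmn
    funext i
    have h1 := hx i
    have h2 := hy i
    simp only [Set.mem_Ioc] at h1 h2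
    have a1 : (m i : ℝ) < n i + 1 := by linarith
    have a2 : (n i : ℝ) < m i + 1 := by linarith
    have a1' : m i < n i + 1 := by exact_mod_cast a1
    have a2' : n i < m i + 1 := by exact_mod_cast a2
    omega
  have key := hasSum_integral_iUnion (μ := volume) hB hd (f := G) hG.integrableOn
  rw [hU, Measure.restrict_univ] at key
  convert key using 2 with m
  have mp := (measurePreserving_add_right (volume : Measure (Fin k → ℝ)) (fun i => (m i : ℝ)))
  have := mp.setIntegral_preimage_emb (MeasurableEquiv.addRight _).measurableEmbedding G (B m)
  rw [← this]
  congr 2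
  ext x
  simp only [B, Set.mem_ofPred_eq, Set.mem_preimage, Pi.add_apply, Set.mem_Ioc]
  refine forall_congr' fun i => ?_
  constructor <;> rintro ⟨h1, h2⟩ <;> constructor <;> linarith

lemma finite_int_box {k : ℕ} (R : ℝ) : {n : Fin k → ℤ | ∀ i, |(n i : ℝ)| ≤ R}.Finite := by
  refine (Set.finite_Icc (fun _ : Fin k => -⌈R⌉) (fun _ => ⌈R⌉)).subset ?_
  intro n hn
  constructor
  · intro i
    have := (abs_le.1 (hn i)).1
    have h2 : (-⌈R⌉ : ℝ) ≤ n i := by linarith [Int.le_ceil R]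
    exact_mod_cast h2
  · intro i
    have := (abs_le.1 (hn i)).2
    have h2 : (n i : ℝ) ≤ ⌈R⌉ := by linarith [Int.le_ceil R]
    exact_mod_cast h2

lemma locFin_shift {k : ℕ} (g : (Fin k → ℝ) → ℂ) (hs : HasCompactSupport g) :
    LocallyFinite (fun n : Fin k → ℤ => Function.support
      (fun x : Fin k → ℝ => g (x + fun i => (n i : ℝ)))) := by
  obtain ⟨R, hR⟩ := hs.isCompact.isBounded.subset_closedBall (0 : Fin k → ℝ)
  intro x
  refine ⟨Metric.ball x 1, Metric.ball_mem_nhds x one_pos, ?_⟩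
  refine (finite_int_box (k := k) (R + ‖x‖ + 1)).subset ?_
  rintro n ⟨y, hy, hyx⟩ i
  have h1 : y + (fun i => (n i : ℝ)) ∈ Metric.closedBall (0 : Fin k → ℝ) R :=
    hR (subset_tsupport _ hy)
  rw [mem_closedBall_zero_iff] at h1
  rw [mem_ball_iff_norm] at hyx
  have h2 := norm_le_pi_norm (y + (fun i => (n i : ℝ))) i
  have h3 := norm_le_pi_norm (y - x) i
  have h4 := norm_le_pi_norm x i
  simp only [Pi.add_apply, Pi.sub_apply, Real.norm_eq_abs] at h2 h3 h4
  have : (n i : ℝ) = (y i + n i) - (y i - x i) - x i := by ring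
  rw [this]
  calc _ ≤ |y i + n i| + |y i - x i| + |x i| := by
        exact (abs_sub _ _).trans (add_le_add (abs_sub _ _) le_rfl)
    _ ≤ _ := by linarith

open MeasureTheory in
/-- Poisson summation on `ℤ^k` for a continuous compactly supported function. -/
lemma poisson_multi {k : ℕ} (g : (Fin k → ℝ) → ℂ) (hc : Continuous g) (hs : HasCompactSupport g)
    (hsum : Summable (fun n : Fin k → ℤ =>
      ∫ x : Fin k → ℝ, Complex.exp (-(2 * Real.pi * Complex.I * ∑ i, (n i : ℂ) * x i)) * g x)) :
    ∑' n : Fin k → ℤ, g (fun i => (n i : ℝ)) = ∑' n : Fin k → ℤ,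
      ∫ x : Fin k → ℝ, Complex.exp (-(2 * Real.pi * Complex.I * ∑ i, (n i : ℂ) * x i)) * g x := by
  let P : (Fin k → ℝ) → ℂ := fun x => ∑' n : Fin k → ℤ, g (x + fun i => (n i : ℝ))
  have hlf := locFin_shift g hs
  have hPc : Continuous P := by
    have : P = fun x => ∑ᶠ n : Fin k → ℤ, g (x + fun i => (n i : ℝ)) := by
      funext x
      exact tsum_eq_finsum (hlf.point_finite x)
    rw [this]
    exact continuous_finsum (fun n => hc.comp (by fun_prop)) hlf
  have hPper : ∀ (x : Fin k → ℝ) (m : Fin k → ℤ), P (x + fun i => (m i : ℝ)) = P x := by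
    intro x m
    simp only [P]
    rw [← (Equiv.addLeft m).tsum_eq (fun n : Fin k → ℤ => g (x + fun i => (n i : ℝ)))]
    refine tsum_congr fun n => ?_
    congr 1
    funext i
    simp [add_assoc]
  let π : (Fin k → ℝ) → UnitAddTorus (Fin k) := fun x i => (x i : UnitAddCircle)
  have hπ : IsOpenQuotientMap π := by
    exact IsOpenQuotientMap.piMap (fun i : Fin k => QuotientAddGroup.isOpenQuotientMap_mk)
  have hPfac : ∀ x y, π x = π y → P x = P y := by
    intro x y hxy
    have : ∀ i, ∃ m : ℤ, x i = y i + m := by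
      intro i
      have h := congrFun hxy i
      simp only [π] at h
      rw [eq_comm, QuotientAddGroup.eq] at h
      obtain ⟨m, hm⟩ := AddSubgroup.mem_zmultiples_iff.1 h
      refine ⟨m, ?_⟩
      simp at hm
      linarith
    choose m hm using this
    have : x = y + fun i => (m i : ℝ) := by funext i; exact hm i
    rw [this, hPper]
  let F : UnitAddTorus (Fin k) → ℂ := fun t => P (Function.surjInv hπ.surjective t)
  have hFπ : ∀ x, F (π x) = P x := fun x => hPfac _ _ (Function.surjInv_eq hπ.surjective _)
  have hFc : Continuous F := by
    rw [hπ.isQuotientMap.continuous_iff]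
    exact hPc.congr (fun x => (hFπ x).symm)
  let FC : C(UnitAddTorus (Fin k), ℂ) := ⟨F, hFc⟩
  have hexp : ∀ (n : Fin k → ℤ) (x : Fin k → ℝ), UnitAddTorus.mFourier (-n) (π x) =
      Complex.exp (-(2 * Real.pi * Complex.I * ∑ i, (n i : ℂ) * x i)) := by
    intro n x
    simp only [UnitAddTorus.mFourier, ContinuousMap.coe_mk, π, fourier_coe_apply, ← Complex.exp_sum]
    congr 1
    rw [Finset.mul_sum, ← Finset.sum_neg_distrib]
    refine Finset.sum_congr rfl fun i _ => ?_
    simp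
    ring
  have hcoeff : ∀ n, UnitAddTorus.mFourierCoeff FC n =
      ∫ x : Fin k → ℝ, Complex.exp (-(2 * Real.pi * Complex.I * ∑ i, (n i : ℂ) * x i)) * g x := by
    intro n
    let G : (Fin k → ℝ) → ℂ := fun x =>
      Complex.exp (-(2 * Real.pi * Complex.I * ∑ i, (n i : ℂ) * x i)) * g x
    have hGc : Continuous G := by fun_prop
    have hGs : HasCompactSupport G := hs.mul_left
    have hGi : Integrable G := hGc.integrable_of_hasCompactSupport hGs
    have hGper : ∀ (x : Fin k → ℝ) (m : Fin k → ℤ), G (x + fun i => (m i : ℝ)) =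
        UnitAddTorus.mFourier (-n) (π x) * g (x + fun i => (m i : ℝ)) := by
      intro x m
      simp only [G]
      rw [← hexp n]
      congr 2
      funext i
      simp only [π, Pi.add_apply]
      rw [AddCircle.coe_add]
      have : ((m i : ℝ) : UnitAddCircle) = 0 := by
        rw [AddCircle.coe_eq_zero_iff]
        exact ⟨m i, by simp⟩
      rw [this, add_zero]
    have h1 := unfold_hasSum G hGi
    have h2 := unfold_hasSum (fun x => ‖G x‖) hGi.norm
    have h3 := hasSum_integral_of_summable_integral_norm
      (μ := volume.restrict {x : Fin k → ℝ | ∀ i, x i ∈ Set.Ioc (0:ℝ) (0 + 1)})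
      (F := fun (m : Fin k → ℤ) x => G (x + fun i => (m i : ℝ)))
      (fun m => (hGi.comp_add_right _).integrableOn) h2.summable
    rw [UnitAddTorus.mFourierCoeff_eq_integral _ n (fun _ => 0), h1.unique h3]
    congr 1
    funext x
    change UnitAddTorus.mFourier (-n) (π x) • F (π x) = _
    rw [hFπ, smul_eq_mul, ← tsum_mul_left]
    exact tsum_congr fun m => (hGper x m).symm
  have hS : Summable (UnitAddTorus.mFourierCoeff FC) := by
    rw [show UnitAddTorus.mFourierCoeff FC = _ from funext hcoeff]
    exact hsum
  have := (UnitAddTorus.hasSum_mFourier_series_apply_of_summable hS (π 0)).tsum_eq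
  have h0 : FC (π 0) = P 0 := hFπ 0
  rw [h0] at this
  have hP0 : P 0 = ∑' n : Fin k → ℤ, g (fun i => (n i : ℝ)) := by simp [P]
  rw [← hP0, ← this]
  refine tsum_congr fun n => ?_
  rw [hcoeff, smul_eq_mul]
  have : UnitAddTorus.mFourier n (π 0) = 1 := by
    have := hexp (-n) 0
    simpa using this
  rw [this, mul_one]

open MeasureTheory in
lemma fhat_scale (w : ℝ → ℝ) (c r l : ℝ) (hr : 0 < r) :
    ∫ y : ℝ, Complex.exp (-(2 * Real.pi * Complex.I * (l * y))) * (w ((y - c) / r) : ℂ) =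
      r * Complex.exp (-(2 * Real.pi * Complex.I * (c * l))) * fhat w (r * l) := by
  let h : ℝ → ℂ := fun z =>
    Complex.exp (-(2 * Real.pi * Complex.I * (l * ((r * z + c : ℝ) : ℂ)))) * (w z : ℂ)
  have h1 : ∫ y : ℝ, Complex.exp (-(2 * Real.pi * Complex.I * (l * y))) * (w ((y - c) / r) : ℂ) =
      ∫ y : ℝ, h ((y - c) / r) := by
    congr 1
    funext y
    simp only [h]
    rw [show r * ((y - c) / r) + c = y by field_simp; ring]
  rw [h1, integral_sub_right_eq_self (fun y => h (y / r)) c, Measure.integral_comp_div,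
    abs_of_pos hr, fhat, Complex.real_smul, mul_assoc]
  congr 1
  rw [← integral_const_mul]
  congr 1
  funext z
  simp only [h]
  rw [mul_comm (w z : ℂ), ← mul_assoc (Complex.exp _) (Complex.exp _), ← Complex.exp_add]
  congr 2
  push_cast
  ring

lemma dualPt_dot {k : ℕ} (A : Matrix (Fin k) (Fin k) ℝ) (hA : IsUnit A.det) (a : Fin k → ℤ)
    (x : Fin k → ℝ) : ∑ i, (a i : ℝ) * x i = ∑ i, dualPt A a i * (A.mulVec x) i := by
  change (fun i => (a i : ℝ)) ⬝ᵥ x = ((A⁻¹).transpose.mulVec (fun i => (a i : ℝ))) ⬝ᵥ (A.mulVec x)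
  rw [Matrix.mulVec_transpose, ← Matrix.dotProduct_mulVec, Matrix.mulVec_mulVec,
    Matrix.nonsing_inv_mul _ hA, Matrix.one_mulVec]

open MeasureTheory in
lemma lattice_poisson {k : ℕ} (A : Matrix (Fin k) (Fin k) ℝ) (hdet : |A.det| = 1)
    (w : Fin k → ℝ → ℝ) (hc : ∀ i, Continuous (w i)) (hs : ∀ i, HasCompactSupport (w i))
    (c r : Fin k → ℝ) (hr : ∀ i, 0 < r i)
    (hsum : Summable (fun a : Fin k → ℤ => ∏ i, (r i * ‖fhat (w i) (r i * dualPt A a i)‖))) :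
    Summable (fun a : Fin k → ℤ => ∏ i, w i ((latPt A a i - c i) / r i)) ∧
    ((∑' a : Fin k → ℤ, ∏ i, w i ((latPt A a i - c i) / r i) : ℝ) : ℂ) =
      ∑' a : Fin k → ℤ, ∏ i, ((r i : ℂ) *
        Complex.exp (-(2 * Real.pi * Complex.I * (c i * dualPt A a i))) *
          fhat (w i) (r i * dualPt A a i)) := by
  have hdet0 : A.det ≠ 0 := by
    intro h; rw [h] at hdet; simp at hdet
  have hA : IsUnit A.det := isUnit_iff_ne_zero.2 hdet0
  let g : (Fin k → ℝ) → ℂ := fun x => ∏ i, (w i ((A.mulVec x i - c i) / r i) : ℂ)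
  have hAc : ∀ B : Matrix (Fin k) (Fin k) ℝ, Continuous (fun x : Fin k → ℝ => B.mulVec x) :=
    fun B => Continuous.matrix_mulVec continuous_const continuous_id
  have hgc : Continuous g := by
    refine continuous_finsetProd _ fun i _ => ?_
    refine Complex.continuous_ofReal.comp ((hc i).comp ?_)
    exact (((continuous_apply i).comp (hAc A)).sub continuous_const).div_const _
  have hgs : HasCompactSupport g := by
    have hK : ∀ i, ∃ K : Set ℝ, IsCompact K ∧ ∀ y ∉ K, w i ((y - c i) / r i) = 0 := by
      intro i
      refine ⟨(fun z => r i * z + c i) '' tsupport (w i),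
        (hs i).isCompact.image (by fun_prop), fun y hy => ?_⟩
      by_contra hne
      apply hy
      refine ⟨(y - c i) / r i, subset_tsupport _ hne, ?_⟩
      have := (hr i).ne'
      field_simp
      ring
    choose K hKc hK using hK
    refine HasCompactSupport.intro
      (K := (fun x : Fin k → ℝ => A⁻¹.mulVec x) '' (Set.univ.pi K))
      ((isCompact_univ_pi hKc).image (hAc _)) ?_
    intro x hx
    have : A.mulVec x ∉ Set.univ.pi K := by
      intro h
      apply hx
      refine ⟨_, h, ?_⟩
      simp [Matrix.mulVec_mulVec, Matrix.nonsing_inv_mul _ hA]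
    simp only [Set.mem_univ_pi, not_forall] at this
    obtain ⟨i, hi⟩ := this
    refine Finset.prod_eq_zero (Finset.mem_univ i) ?_
    rw [hK i _ hi]
    simp
  have hfin : Summable (fun a : Fin k → ℤ => ∏ i, w i ((latPt A a i - c i) / r i)) := by
    refine summable_of_finite_support (((locFin_shift g hgs).point_finite 0).subset ?_)
    intro a ha h0
    apply ha
    simp only [g, zero_add] at h0
    rw [← Complex.ofReal_prod] at h0
    exact_mod_cast h0
  refine ⟨hfin, ?_⟩
  have hmap : Measure.map (fun x : Fin k → ℝ => A.mulVec x) volume = volume := by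
    have := Real.map_matrix_volume_pi_eq_smul_volume_pi hdet0
    rw [abs_inv, hdet] at this
    have h2 : (fun x : Fin k → ℝ => A.mulVec x) = ⇑(Matrix.toLin' A) := by
      funext x; simp
    rw [h2]
    simpa using this
  have hF : ∀ a : Fin k → ℤ,
      ∫ x : Fin k → ℝ, Complex.exp (-(2 * Real.pi * Complex.I * ∑ i, (a i : ℂ) * x i)) * g x =
      ∏ i, ((r i : ℂ) *
        Complex.exp (-(2 * Real.pi * Complex.I * (c i * dualPt A a i))) *
          fhat (w i) (r i * dualPt A a i)) := by
    intro a
    let h : (Fin k → ℝ) → ℂ := fun y => ∏ i,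
      (Complex.exp (-(2 * Real.pi * Complex.I * ((dualPt A a i : ℝ) * y i))) *
        (w i ((y i - c i) / r i) : ℂ))
    have hh : Continuous h := by
      refine continuous_finsetProd _ fun i _ => ?_
      refine Continuous.mul (by fun_prop) ?_
      refine Complex.continuous_ofReal.comp ((hc i).comp ?_)
      fun_prop
    have h1 : ∀ x : Fin k → ℝ,
        Complex.exp (-(2 * Real.pi * Complex.I * ∑ i, (a i : ℂ) * x i)) * g x =
          h (A.mulVec x) := by
      intro x
      simp only [h, g]
      rw [Finset.prod_mul_distrib, ← Complex.exp_sum]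
      congr 2
      have := congrArg (fun t : ℝ => (t : ℂ)) (dualPt_dot A hA a x)
      push_cast at this
      rw [this, Finset.mul_sum, Finset.sum_neg_distrib]
    simp_rw [h1]
    rw [← integral_map (φ := fun x : Fin k → ℝ => A.mulVec x) (f := h)
      (hAc A).measurable.aemeasurable hh.aestronglyMeasurable, hmap]
    simp only [h]
    rw [integral_fintype_prod_volume_eq_prod (fun i (y : ℝ) =>
      (Complex.exp (-(2 * Real.pi * Complex.I * ((dualPt A a i : ℝ) * y))) *
        (w i ((y - c i) / r i) : ℂ)))]
    refine Finset.prod_congr rfl fun i _ => ?_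
    exact fhat_scale _ _ _ _ (hr i)
  have hP := poisson_multi g hgc hgs (by
    simp_rw [hF]
    refine Summable.of_norm (hsum.congr fun a => ?_)
    rw [norm_prod]
    refine Finset.prod_congr rfl fun i _ => ?_
    rw [norm_mul, norm_mul, Complex.norm_real, Real.norm_of_nonneg (hr i).le, Complex.norm_exp]
    have : (-(2 * Real.pi * Complex.I * (c i * dualPt A a i : ℂ))).re = 0 := by
      simp
    rw [this]
    simp)
  simp_rw [hF] at hP
  rw [← hP, Complex.ofReal_tsum]
  refine tsum_congr fun a => ?_
  simp [g, latPt]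

open MeasureTheory FourierTransform in
lemma fhat_decay (ℓ : ℕ) (w : ℝ → ℝ) (hw : ContDiff ℝ ℓ w) (hs : HasCompactSupport w) :
    ∃ C : ℝ, 0 < C ∧ ∀ t, ‖fhat w t‖ ≤ C ∧ |t| ^ ℓ * ‖fhat w t‖ ≤ C := by
  let f : ℝ → ℂ := fun x => (w x : ℂ)
  have hf : ContDiff ℝ ((ℓ : ℕ∞) : WithTop ℕ∞) f := Complex.ofRealCLM.contDiff.comp hw
  have hfs : HasCompactSupport f := hs.comp_left (g := fun x : ℝ => (x : ℂ)) (by simp)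
  have hint : ∀ n : ℕ, (n : ℕ∞) ≤ (ℓ : ℕ∞) → Integrable (iteratedDeriv n f) := by
    intro n hn
    refine (hf.continuous_iteratedDeriv n (by exact_mod_cast hn)).integrable_of_hasCompactSupport ?_
    exact (hfs.iteratedFDeriv (𝕜 := ℝ) n).comp_left (g := fun m => m (fun _ => 1)) (by simp)
  have hF : ∀ t, fhat w t = 𝓕 f t := by
    intro t
    rw [Real.fourier_real_eq_integral_exp_smul, fhat]
    congr 1
    funext x
    simp only [f, smul_eq_mul]
    rw [mul_comm]
    congr 2
    push_cast
    ring
  have hb : ∀ (u : ℝ → ℂ) t, ‖𝓕 u t‖ ≤ ∫ x, ‖u x‖ := fun u t => by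
    exact VectorFourier.norm_fourierIntegral_le_integral_norm _ _ _ _ _
  have hD := Real.fourier_iteratedDeriv hf hint (le_refl _)
  refine ⟨(∫ x, ‖f x‖) + (∫ x, ‖iteratedDeriv ℓ f x‖) + 1, ?_, fun t => ⟨?_, ?_⟩⟩
  · have h1 : 0 ≤ ∫ x, ‖f x‖ := by positivity
    have h2 : 0 ≤ ∫ x, ‖iteratedDeriv ℓ f x‖ := by positivity
    linarith
  · have h2 : 0 ≤ ∫ x, ‖iteratedDeriv ℓ f x‖ := by positivity
    rw [hF]
    linarith [hb f t]
  · have h1 : 0 ≤ ∫ x, ‖f x‖ := by positivity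
    have h3 := hb (iteratedDeriv ℓ f) t
    rw [hD, norm_smul, norm_pow] at h3
    have h4 : |t| ^ ℓ ≤ ‖(2 * Real.pi * Complex.I * t : ℂ)‖ ^ ℓ := by
      gcongr
      simp only [norm_mul, Complex.norm_I, Complex.norm_real, Real.norm_eq_abs, Complex.norm_ofNat,
        abs_of_pos Real.pi_pos]
      nlinarith [abs_nonneg t, Real.pi_gt_three]
    rw [hF]
    have := mul_le_mul_of_nonneg_right h4 (norm_nonneg (𝓕 f t))
    linarith

lemma count_sep {ι : Type*} (s : Finset ι) (f : ι → ℝ) (δ T : ℝ) (hδ : 0 < δ) (hT0 : 0 ≤ T)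
    (hsep : ∀ a ∈ s, ∀ b ∈ s, a ≠ b → δ ≤ |f a - f b|) (hlow : ∀ a ∈ s, δ ≤ |f a|)
    (hT : ∀ a ∈ s, |f a| ≤ T) : (s.card : ℝ) ≤ 4 * T / δ := by
  rcases s.eq_empty_or_nonempty with rfl | ⟨a0, ha0⟩
  · simp only [Finset.card_empty, Nat.cast_zero]
    positivity
  have hTδ : 1 ≤ T / δ := by
    rw [one_le_div hδ]
    exact (hlow a0 ha0).trans (hT a0 ha0)
  have hcard : s.card ≤ (Finset.Icc ⌊-(T / δ)⌋ ⌊T / δ⌋).card := by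
    refine Finset.card_le_card_of_injOn (fun a => ⌊f a / δ⌋) ?_ ?_
    · intro a ha
      have h := abs_le.1 (hT a ha)
      simp only [Finset.coe_Icc, Set.mem_Icc]
      constructor
      · apply Int.floor_mono
        rw [← neg_div]
        gcongr
        exact h.1
      · apply Int.floor_mono
        gcongr
        exact h.2
    · intro a ha b hb hab
      by_contra hne
      have h1 := Int.abs_sub_lt_one_of_floor_eq_floor hab
      rw [← sub_div, abs_div, abs_of_pos hδ, div_lt_one hδ] at h1
      linarith [hsep a ha b hb hne]
  have h2 : ((Finset.Icc ⌊-(T / δ)⌋ ⌊T / δ⌋).card : ℝ) ≤ 2 * (T / δ) + 2 := by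
    rw [Int.card_Icc]
    have h3 : (0:ℤ) ≤ ⌊T / δ⌋ + 1 - ⌊-(T / δ)⌋ := by
      have : ⌊-(T / δ)⌋ ≤ ⌊T / δ⌋ := Int.floor_mono (by linarith)
      linarith
    have h4 : (((⌊T / δ⌋ + 1 - ⌊-(T / δ)⌋).toNat : ℤ) : ℝ) =
        ((⌊T / δ⌋ + 1 - ⌊-(T / δ)⌋ : ℤ) : ℝ) := by rw [Int.toNat_of_nonneg h3]
    rw [Int.cast_natCast] at h4
    rw [h4]
    push_cast
    linarith [Int.floor_le (T / δ), Int.lt_floor_add_one (-(T / δ))]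
  calc (s.card : ℝ) ≤ _ := by exact_mod_cast hcard
    _ ≤ _ := h2
    _ ≤ 4 * (T / δ) := by linarith
    _ = _ := by ring

lemma dualPt_sub {k : ℕ} (A : Matrix (Fin k) (Fin k) ℝ) (a b : Fin k → ℤ) (i : Fin k) :
    dualPt A (a - b) i = dualPt A a i - dualPt A b i := by
  have : (fun i => ((a - b) i : ℝ)) = (fun i => (a i : ℝ)) - (fun i => (b i : ℝ)) := by
    funext i; simp
  rw [dualPt, this, Matrix.mulVec_sub]
  rfl

lemma dualPt_ne {k : ℕ} (A : Matrix (Fin k) (Fin k) ℝ) (hA : IsUnit A.det) (a : Fin k → ℤ)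
    (ha : a ≠ 0) : dualPt A a ≠ 0 := by
  intro h
  apply ha
  have h1 : A.transpose.mulVec (dualPt A a) = fun i => (a i : ℝ) := by
    rw [dualPt, Matrix.mulVec_mulVec, ← Matrix.transpose_mul, Matrix.nonsing_inv_mul _ hA]
    simp
  rw [h, Matrix.mulVec_zero] at h1
  funext i
  have := congrFun h1 i
  simp only [Pi.zero_apply] at this
  exact_mod_cast this.symm

lemma box_count (d : ℕ) (A : Matrix (Fin (d+1)) (Fin (d+1)) ℝ) (hA : IsUnit A.det) (φ : ℝ → ℝ)
    (hφmap : ∀ x, 1 ≤ x → 1 ≤ φ x)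
    (hφmono : ∀ x y, 1 ≤ x → x ≤ y → φ x ≤ φ y)
    (hbad : DualBad d A φ) (R : Fin d → ℝ) (hR : ∀ i, 1 ≤ R i) (T : ℝ) (hT : 0 ≤ T)
    (s : Finset (Fin (d+1) → ℤ)) (hs0 : ∀ a ∈ s, a ≠ 0)
    (hsR : ∀ a ∈ s, ∀ i : Fin d, |dualPt A a i.castSucc| ≤ R i)
    (hsT : ∀ a ∈ s, |dualPt A a (Fin.last d)| ≤ T) :
    (s.card : ℝ) ≤ 4 * T * ((∏ i, (2 * R i)) * φ (∏ i, (2 * R i))) := by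
  set X := ∏ i, (2 * R i) with hX
  have hX1 : 1 ≤ X := by
    have := Finset.prod_le_prod (s := (Finset.univ : Finset (Fin d))) (f := fun _ => (1:ℝ))
      (g := fun i => 2 * R i) (fun _ _ => zero_le_one) (fun i _ => by linarith [hR i])
    simpa using this
  have hφX : 1 ≤ φ X := hφmap X hX1
  have key : ∀ a : Fin (d+1) → ℤ, a ≠ 0 → (∀ i : Fin d, |dualPt A a i.castSucc| ≤ 2 * R i) →
      1 / (X * φ X) ≤ |dualPt A a (Fin.last d)| := by
    intro a ha haR
    have hb := hbad a (dualPt_ne A hA a ha)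
    set H := Hmul (fun i : Fin d => dualPt A a i.castSucc) with hH
    have hH1 : 1 ≤ H := by
      have := Finset.prod_le_prod (s := (Finset.univ : Finset (Fin d))) (f := fun _ => (1:ℝ))
        (g := fun i => max 1 |dualPt A a i.castSucc|) (fun _ _ => zero_le_one)
        (fun i _ => le_max_left _ _)
      simpa [hH, Hmul] using this
    have hHX : H ≤ X := by
      refine Finset.prod_le_prod (fun i _ => le_trans zero_le_one (le_max_left _ _)) fun i _ => ?_
      exact max_le (by linarith [hR i]) (haR i)
    have hφH : φ H ≤ φ X := hφmono _ _ hH1 hHX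
    have hφH1 : 1 ≤ φ H := hφmap _ hH1
    have h1 : 1 < H * φ H * |dualPt A a (Fin.last d)| := by
      rw [gt_iff_lt, div_lt_iff₀ (by linarith)] at hb
      linarith
    rw [div_le_iff₀ (by positivity)]
    have : H * φ H ≤ X * φ X := by gcongr
    nlinarith [abs_nonneg (dualPt A a (Fin.last d))]
  have := count_sep s (fun a => dualPt A a (Fin.last d)) (1 / (X * φ X)) T (by positivity) hT
    (fun a ha b hb hab => by
      rw [← dualPt_sub]
      refine key _ (sub_ne_zero.2 hab) fun i => ?_
      rw [dualPt_sub]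
      have := abs_sub (dualPt A a i.castSucc) (dualPt A b i.castSucc)
      linarith [hsR a ha i, hsR b hb i])
    (fun a ha => key a (hs0 a ha) fun i => by linarith [hsR a ha i, hR i])
    hsT
  refine this.trans (le_of_eq ?_)
  rw [div_div_eq_mul_div, div_one]

lemma exists_dyadic : ∃ J : ℝ → ℕ, (∀ t, |t| ≤ 2 ^ J t) ∧
    ∀ (t C v : ℝ) (ℓ : ℕ), 0 ≤ v → v ≤ C → |t| ^ ℓ * v ≤ C → v ≤ C * 2 ^ ℓ * ((2 ^ J t) ^ ℓ)⁻¹ := by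
  classical
  have hex : ∀ t : ℝ, ∃ j : ℕ, |t| ≤ 2 ^ j := fun t =>
    (pow_unbounded_of_one_lt |t| one_lt_two).imp fun _ h => h.le
  refine ⟨fun t => Nat.find (hex t), fun t => Nat.find_spec (hex t), ?_⟩
  intro t C v ℓ hv hvC ht
  rw [← div_eq_mul_inv, le_div_iff₀ (by positivity)]
  change v * (2 ^ Nat.find (hex t)) ^ ℓ ≤ C * 2 ^ ℓ
  rcases h : Nat.find (hex t) with _ | j
  · have : (1:ℝ) ≤ 2 ^ ℓ := one_le_pow₀ one_le_two
    rw [pow_zero, one_pow]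
    nlinarith
  · have hj : 2 ^ j < |t| := by
      have := Nat.find_min (hex t) (m := j) (by omega)
      exact not_le.1 this
    have h2 : ((2:ℝ) ^ j) ^ ℓ ≤ |t| ^ ℓ := by gcongr
    have h3 : ((2:ℝ) ^ (j+1)) ^ ℓ = (2 ^ j) ^ ℓ * 2 ^ ℓ := by rw [← mul_pow, pow_succ]
    rw [h3, ← mul_assoc]
    gcongr
    nlinarith

lemma sum_geom_le {k : ℕ} (s : Finset (Fin k → ℕ)) :
    ∑ J ∈ s, ∏ i, ((2:ℝ) ^ J i)⁻¹ ≤ 2 ^ k := by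
  classical
  obtain ⟨M, hM⟩ : ∃ M, ∀ J ∈ s, ∀ i, J i < M := by
    refine ⟨(s.sup fun J => Finset.univ.sup J) + 1, fun J hJ i => Nat.lt_succ_of_le ?_⟩
    exact (Finset.le_sup (f := J) (Finset.mem_univ i)).trans
      (Finset.le_sup (f := fun J : Fin k → ℕ => Finset.univ.sup J) hJ)
  calc _ ≤ ∑ J ∈ Fintype.piFinset (fun _ : Fin k => Finset.range M), ∏ i, ((2:ℝ) ^ J i)⁻¹ := by
        refine Finset.sum_le_sum_of_subset_of_nonneg ?_ fun _ _ _ => by positivity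
        intro J hJ
        rw [Fintype.mem_piFinset]
        exact fun i => Finset.mem_range.2 (hM J hJ i)
    _ = ∏ i : Fin k, ∑ j ∈ Finset.range M, ((2:ℝ) ^ j)⁻¹ := by
        rw [Finset.prod_univ_sum]
    _ ≤ ∏ i : Fin k, 2 := by
        refine Finset.prod_le_prod (fun _ _ => by positivity) fun i _ => ?_
        have := sum_geometric_two_le M
        simpa [one_div, inv_pow] using this
    _ = 2 ^ k := by simp

lemma fin_sum_bound (d : ℕ) (A : Matrix (Fin (d+1)) (Fin (d+1)) ℝ) (hA : IsUnit A.det)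
    (φ : ℝ → ℝ) (hφmap : ∀ x, 1 ≤ x → 1 ≤ φ x)
    (hφmono : ∀ x y, 1 ≤ x → x ≤ y → φ x ≤ φ y)
    (hbad : DualBad d A φ) (m : ℕ) (C₁ : ℝ)
    (hφ2 : ∀ (n : ℕ) x, 1 ≤ x → φ (2 ^ n * x) ≤ C₁ * (2 ^ n) ^ m * φ x)
    (v : Fin (d+1) → ℝ → ℝ) (hv0 : ∀ i t, 0 ≤ v i t) (C : Fin (d+1) → ℝ) (hC : ∀ i, 0 < C i)
    (hv : ∀ i t, v i t ≤ C i ∧ |t| ^ (m+2) * v i t ≤ C i) :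
    ∃ K : ℝ, 0 < K ∧ ∀ r : Fin (d+1) → ℝ, (∀ i, 0 < r i) → (∀ i : Fin d, r i.castSucc ≤ 1) →
      ∀ s : Finset (Fin (d+1) → ℤ), (∀ a ∈ s, a ≠ 0) →
      ∑ a ∈ s, ∏ i, (r i * v i (r i * dualPt A a i)) ≤ K * φ (1 / ∏ i : Fin d, r i.castSucc) := by
  classical
  obtain ⟨J, hJ1, hJ2⟩ := exists_dyadic
  have hC₁ : 0 < C₁ := by
    have h1 := hφ2 0 1 le_rfl
    have h2 := hφmap 1 le_rfl
    simp at h1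
    by_contra h
    nlinarith
  let D := ∏ i, (C i * 2 ^ (m+2))
  have hD : 0 < D := Finset.prod_pos fun i _ => by have := hC i; positivity
  refine ⟨4 * D * C₁ * 2 ^ d * (2 ^ d) ^ m * 2 ^ (d+1), by positivity, ?_⟩
  intro r hr hr1 s hs
  set V := ∏ i : Fin d, r i.castSucc with hV
  have hVpos : 0 < V := Finset.prod_pos fun i _ => hr _
  have hV1 : V ≤ 1 := Finset.prod_le_one (fun i _ => (hr _).le) fun i _ => hr1 i
  have hV1' : 1 ≤ 1 / V := by rw [one_le_div hVpos]; exact hV1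
  set N := r (Fin.last d) with hN
  have hNpos : 0 < N := hr _
  have hφV : 1 ≤ φ (1 / V) := hφmap _ hV1'
  let JJ : (Fin (d+1) → ℤ) → (Fin (d+1) → ℕ) := fun a i => J (r i * dualPt A a i)
  let F : (Fin (d+1) → ℕ) → ℝ := fun j => V * N * D * ∏ i, (((2:ℝ) ^ j i) ^ (m+2))⁻¹
  have hF0 : ∀ j, 0 ≤ F j := fun j => by positivity
  have step1 : ∑ a ∈ s, ∏ i, (r i * v i (r i * dualPt A a i)) ≤ ∑ a ∈ s, F (JJ a) := by
    refine Finset.sum_le_sum fun a _ => ?_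
    have hrw : F (JJ a) = ∏ i, (r i * (C i * 2 ^ (m+2) * (((2:ℝ) ^ JJ a i) ^ (m+2))⁻¹)) := by
      rw [Finset.prod_mul_distrib, Fin.prod_univ_castSucc r, Finset.prod_mul_distrib]
      change V * N * D * _ = V * N * (D * _)
      rw [mul_assoc (V * N)]
    rw [hrw]
    refine Finset.prod_le_prod (fun i _ => mul_nonneg (hr i).le (hv0 _ _)) fun i _ => ?_
    refine mul_le_mul_of_nonneg_left ?_ (hr i).le
    exact hJ2 _ _ _ _ (hv0 _ _) (hv i _).1 (hv i _).2
  refine step1.trans ?_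
  rw [Finset.sum_comp F JJ]
  have step2 : ∀ j ∈ Finset.image JJ s, (s.filter fun a => JJ a = j).card • F j ≤
      (4 * D * C₁ * 2 ^ d * (2 ^ d) ^ m * φ (1 / V)) * ∏ i, ((2:ℝ) ^ j i)⁻¹ := by
    intro j _
    rw [nsmul_eq_mul]
    have hb : ∀ a ∈ s.filter (fun a => JJ a = j), ∀ i, |dualPt A a i| ≤ 2 ^ j i / r i := by
      intro a ha i
      have h1 := hJ1 (r i * dualPt A a i)
      have h2 : J (r i * dualPt A a i) = j i := congrFun (Finset.mem_filter.1 ha).2 i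
      rw [h2, abs_mul, abs_of_pos (hr i)] at h1
      rw [le_div_iff₀ (hr i)]
      linarith
    have hcard := box_count d A hA φ hφmap hφmono hbad (fun i => 2 ^ j i.castSucc / r i.castSucc)
      (fun i => by
        rw [one_le_div (hr _)]
        exact (hr1 i).trans (one_le_pow₀ one_le_two))
      (2 ^ j (Fin.last d) / N) (by positivity) (s.filter fun a => JJ a = j)
      (fun a ha => hs a (Finset.mem_filter.1 ha).1)
      (fun a ha i => hb a ha _) (fun a ha => hb a ha _)
    set S := ∑ i : Fin d, j i.castSucc with hS
    set x : ℝ := 2 ^ S with hx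
    set y : ℝ := 2 ^ j (Fin.last d) with hy
    have hx1 : 1 ≤ x := one_le_pow₀ one_le_two
    have hy1 : 1 ≤ y := one_le_pow₀ one_le_two
    have hX : ∏ i : Fin d, (2 * ((2:ℝ) ^ j i.castSucc / r i.castSucc)) = 2 ^ (d + S) * (1 / V) := by
      rw [Finset.prod_mul_distrib, Finset.prod_div_distrib, Finset.prod_pow_eq_pow_sum]
      simp [pow_add, hV, hS]
      ring
    rw [hX] at hcard
    have hφX := hφ2 (d + S) (1 / V) hV1'
    have hprod : ∀ f : ℕ → ℝ, ∏ i, f (j i) = (∏ i : Fin d, f (j i.castSucc)) * f (j (Fin.last d)) :=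
      fun f => Fin.prod_univ_castSucc _
    have hFj : F j = V * N * D * ((x ^ (m+2))⁻¹ * (y ^ (m+2))⁻¹) := by
      simp only [F]
      rw [hprod (fun n => (((2:ℝ) ^ n) ^ (m+2))⁻¹), Finset.prod_inv_distrib, Finset.prod_pow,
        Finset.prod_pow_eq_pow_sum]
    have hG : ∏ i, ((2:ℝ) ^ j i)⁻¹ = x⁻¹ * y⁻¹ := by
      rw [hprod (fun n => ((2:ℝ) ^ n)⁻¹), Finset.prod_inv_distrib, Finset.prod_pow_eq_pow_sum]
    rw [hG]
    have hyy : y * (y ^ (m+2))⁻¹ ≤ y⁻¹ := by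
      rw [← div_eq_mul_inv, div_le_iff₀ (by positivity), pow_add]
      have : 1 ≤ y ^ m := one_le_pow₀ hy1
      have : y⁻¹ * (y ^ m * y ^ 2) = y ^ m * y := by field_simp
      rw [this]
      nlinarith
    calc _ ≤ (4 * (y / N) * (2 ^ (d + S) * (1 / V) *
          (C₁ * (2 ^ (d + S)) ^ m * φ (1 / V)))) * F j := by
          refine mul_le_mul_of_nonneg_right (hcard.trans ?_) (hF0 j)
          gcongr
      _ = (4 * D * C₁ * 2 ^ d * (2 ^ d) ^ m * φ (1 / V)) * (x⁻¹ * (y * (y ^ (m+2))⁻¹)) := by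
          rw [hFj, pow_add (2:ℝ) d S, ← hx]
          field_simp
          rw [mul_pow]
          ring
      _ ≤ _ := by gcongr
  refine (Finset.sum_le_sum step2).trans ?_
  rw [← Finset.mul_sum]
  refine (mul_le_mul_of_nonneg_left (sum_geom_le _) (by positivity)).trans (le_of_eq ?_)
  ring

lemma phi_growth (φ : ℝ → ℝ) (ξ : ℝ) (ℓ : ℕ)
    (hφmap : ∀ x, 1 ≤ x → 1 ≤ φ x)
    (hφmono : ∀ x y, 1 ≤ x → x ≤ y → φ x ≤ φ y)
    (hbdd : Filter.IsBoundedUnder (· ≤ ·) Filter.atTop (fun x : ℝ => φ (2 * x) / φ x))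
    (hξ : ξ = Filter.limsup (fun x : ℝ => φ (2 * x) / φ x) Filter.atTop)
    (hℓ : (ℓ : ℝ) > 2 + 2 * Real.log ξ / Real.log 2) :
    ∃ (m : ℕ) (C₁ : ℝ), ℓ = m + 2 ∧
      ∀ (n : ℕ) x, 1 ≤ x → φ (2 ^ n * x) ≤ C₁ * (2 ^ n) ^ m * φ x := by
  have hξ1 : 1 ≤ ξ := by
    rw [hξ]
    refine Filter.le_limsup_of_frequently_le (Filter.Eventually.frequently ?_) hbdd
    filter_upwards [Filter.eventually_ge_atTop 1] with x hx
    have h1 := hφmap x hx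
    rw [one_le_div (by linarith)]
    exact hφmono _ _ hx (by linarith)
  have hl2 : 0 < Real.log 2 := Real.log_pos one_lt_two
  have hlξ : 0 ≤ Real.log ξ := Real.log_nonneg hξ1
  have hnn : 0 ≤ 2 * Real.log ξ / Real.log 2 := by positivity
  have hℓ2 : 2 ≤ ℓ := by
    have : (2:ℝ) < ℓ := by linarith
    exact_mod_cast this.le
  obtain ⟨m, rfl⟩ : ∃ m, ℓ = m + 2 := ⟨ℓ - 2, by omega⟩
  have hξm : ξ < 2 ^ m := by
    rw [← Real.log_lt_log_iff (by linarith) (by positivity), Real.log_pow]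
    push_cast at hℓ
    have h1 : 2 * Real.log ξ / Real.log 2 < m := by linarith
    rw [div_lt_iff₀ hl2] at h1
    linarith
  rw [hξ] at hξm
  have hev := Filter.eventually_lt_of_limsup_lt hξm hbdd
  obtain ⟨x₀, hx₀⟩ := Filter.eventually_atTop.1 hev
  obtain ⟨p, hp⟩ := pow_unbounded_of_one_lt x₀ (one_lt_two (α := ℝ))
  have hstep : ∀ x, 1 ≤ x → x₀ ≤ x → φ (2 * x) ≤ 2 ^ m * φ x := by
    intro x hx hx0
    have h1 := hφmap x hx
    have := hx₀ x hx0
    rw [div_lt_iff₀ (by linarith)] at this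
    exact this.le
  have hiter : ∀ (n : ℕ) x, 1 ≤ x → x₀ ≤ x → φ (2 ^ n * x) ≤ (2 ^ n) ^ m * φ x := by
    intro n
    induction n with
    | zero => intro x _ _; simp
    | succ n ih =>
      intro x hx hx0
      have h1 : (1:ℝ) ≤ 2 ^ n := one_le_pow₀ one_le_two
      have h2 : x ≤ 2 ^ n * x := by nlinarith
      have h3 := hstep (2 ^ n * x) (hx.trans h2) (hx0.trans h2)
      have h4 := ih x hx hx0
      calc φ (2 ^ (n+1) * x) = φ (2 * (2 ^ n * x)) := by ring_nf
        _ ≤ 2 ^ m * φ (2 ^ n * x) := h3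
        _ ≤ 2 ^ m * ((2 ^ n) ^ m * φ x) := by gcongr
        _ = _ := by rw [pow_succ, mul_pow]; ring
  have hp1 : (1:ℝ) ≤ 2 ^ p := one_le_pow₀ one_le_two
  have hC : 0 ≤ φ (2 ^ p * 2 ^ p) := by
    have := hφmap (2 ^ p * 2 ^ p) (by nlinarith)
    linarith
  refine ⟨m, (2 ^ p) ^ m + φ (2 ^ p * 2 ^ p), rfl, fun n x hx => ?_⟩
  have hφx := hφmap x hx
  have hpx : φ (2 ^ p * x) ≤ ((2 ^ p) ^ m + φ (2 ^ p * 2 ^ p)) * φ x := by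
    rcases le_total x₀ x with h | h
    · have := hiter p x hx h
      nlinarith
    · have h1 : φ (2 ^ p * x) ≤ φ (2 ^ p * 2 ^ p) := by
        refine hφmono _ _ (by nlinarith) ?_
        have : x ≤ 2 ^ p := h.trans hp.le
        gcongr
      have h2 : (0:ℝ) ≤ (2 ^ p) ^ m := by positivity
      nlinarith
  have hn1 : (1:ℝ) ≤ 2 ^ n := one_le_pow₀ one_le_two
  calc φ (2 ^ n * x) ≤ φ (2 ^ n * (2 ^ p * x)) := by
        refine hφmono _ _ (by nlinarith) ?_
        have : x ≤ 2 ^ p * x := by nlinarith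
        gcongr
    _ ≤ (2 ^ n) ^ m * φ (2 ^ p * x) := hiter n _ (by nlinarith) (by nlinarith)
    _ ≤ (2 ^ n) ^ m * (((2 ^ p) ^ m + φ (2 ^ p * 2 ^ p)) * φ x) := by gcongr
    _ = _ := by ring

lemma fhat_zero_real (w : ℝ → ℝ) : fhat w 0 = ((fhat w 0).re : ℂ) := by
  have : fhat w 0 = ((∫ x, w x : ℝ) : ℂ) := by
    rw [fhat, ← integral_complex_ofReal]
    simp
  rw [this]
  simp

lemma disc_bound (d : ℕ) (A : Matrix (Fin (d+1)) (Fin (d+1)) ℝ) (hdet : |A.det| = 1)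
    (φ : ℝ → ℝ) (hφmap : ∀ x, 1 ≤ x → 1 ≤ φ x)
    (hφmono : ∀ x y, 1 ≤ x → x ≤ y → φ x ≤ φ y)
    (hbad : DualBad d A φ) (m : ℕ) (C₁ : ℝ)
    (hφ2 : ∀ (n : ℕ) x, 1 ≤ x → φ (2 ^ n * x) ≤ C₁ * (2 ^ n) ^ m * φ x)
    (w : Fin (d+1) → ℝ → ℝ) (hw : ∀ i, ContDiff ℝ ((m + 2 : ℕ) : WithTop ℕ∞) (w i))
    (hs : ∀ i, HasCompactSupport (w i)) :
    ∃ K : ℝ, 0 < K ∧ ∀ c r : Fin (d+1) → ℝ, (∀ i, 0 < r i) → (∀ i : Fin d, r i.castSucc ≤ 1) →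
      Summable (fun a : Fin (d+1) → ℤ => ∏ i, w i ((latPt A a i - c i) / r i)) ∧
      |(∑' a : Fin (d+1) → ℤ, ∏ i, w i ((latPt A a i - c i) / r i)) - smoothC w * ∏ i, r i| ≤
        K * φ (1 / ∏ i : Fin d, r i.castSucc) := by
  classical
  have hA : IsUnit A.det := by
    rw [isUnit_iff_ne_zero]; intro h; rw [h] at hdet; simp at hdet
  choose C hC hCd using fun i => fhat_decay (m+2) (w i) (hw i) (hs i)
  obtain ⟨K, hK, hKs⟩ := fin_sum_bound d A hA φ hφmap hφmono hbad m C₁ hφ2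
    (fun i t => ‖fhat (w i) t‖) (fun _ _ => norm_nonneg _) C hC hCd
  refine ⟨K, hK, fun c r hr hr1 => ?_⟩
  have hb := hKs r hr hr1
  let T : (Fin (d+1) → ℤ) → ℝ := fun a => ∏ i, (r i * ‖fhat (w i) (r i * dualPt A a i)‖)
  have hT0 : ∀ a, 0 ≤ T a := fun a =>
    Finset.prod_nonneg fun i _ => mul_nonneg (hr i).le (norm_nonneg _)
  let B := K * φ (1 / ∏ i : Fin d, r i.castSucc)
  have hTs : Summable T := by
    refine summable_of_sum_le (c := T 0 + B) hT0 fun u => ?_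
    calc ∑ a ∈ u, T a ≤ ∑ a ∈ insert 0 (u.erase 0), T a := by
          refine Finset.sum_le_sum_of_subset_of_nonneg ?_ fun a _ _ => hT0 a
          exact Finset.insert_erase_subset 0 u
      _ = T 0 + ∑ a ∈ u.erase 0, T a := Finset.sum_insert (by simp)
      _ ≤ T 0 + B := by
          gcongr
          exact hb _ fun a ha => (Finset.mem_erase.1 ha).1
  obtain ⟨hsm, hP⟩ := lattice_poisson A hdet w (fun i => (hw i).continuous) hs c r hr hTs
  refine ⟨hsm, ?_⟩
  let Z : (Fin (d+1) → ℤ) → ℂ := fun a => ∏ i, ((r i : ℂ) *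
        Complex.exp (-(2 * Real.pi * Complex.I * (c i * dualPt A a i))) *
          fhat (w i) (r i * dualPt A a i))
  have hZT : ∀ a, ‖Z a‖ = T a := by
    intro a
    simp only [Z, T]
    rw [norm_prod]
    refine Finset.prod_congr rfl fun i _ => ?_
    rw [norm_mul, norm_mul, Complex.norm_real, Real.norm_of_nonneg (hr i).le, Complex.norm_exp]
    have : (-(2 * Real.pi * Complex.I * (c i * dualPt A a i : ℂ))).re = 0 := by
      simp
    rw [this]
    simp
  have hZs : Summable Z := Summable.of_norm (hTs.congr fun a => (hZT a).symm)
  have hZ0 : Z 0 = ((smoothC w * ∏ i, r i : ℝ) : ℂ) := by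
    have hd0 : dualPt A 0 = 0 := by
      have : (fun i : Fin (d+1) => (((0 : Fin (d+1) → ℤ) i : ℤ) : ℝ)) = 0 := by funext i; simp
      rw [dualPt, this, Matrix.mulVec_zero]
    simp only [Z, hd0, Pi.zero_apply, mul_zero, Complex.ofReal_zero, neg_zero, Complex.exp_zero,
      mul_one, smoothC]
    rw [Finset.prod_mul_distrib, mul_comm]
    push_cast
    congr 1
    exact Finset.prod_congr rfl fun i _ => fhat_zero_real (w i)
  have hsplit := hZs.tsum_eq_add_tsum_ite 0
  have hfin : ((∑' a : Fin (d+1) → ℤ, ∏ i, w i ((latPt A a i - c i) / r i)) -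
      smoothC w * ∏ i, r i : ℝ) = ∑' a, if a = 0 then 0 else Z a := by
    have hP' : ((∑' a : Fin (d+1) → ℤ, ∏ i, w i ((latPt A a i - c i) / r i) : ℝ) : ℂ) =
      ∑' a, Z a := hP
    rw [Complex.ofReal_sub, hP', hsplit, hZ0]
    ring
  rw [← Real.norm_eq_abs, ← Complex.norm_real, hfin]
  have hn : ∀ a, ‖(if a = 0 then 0 else Z a)‖ = if a = 0 then 0 else T a := by
    intro a
    split_ifs
    · simp
    · exact hZT a
  have hle : ∀ u : Finset (Fin (d+1) → ℤ), ∑ a ∈ u, (if a = 0 then 0 else T a) ≤ B := by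
    intro u
    have h1 : ∑ a ∈ u, (if a = 0 then 0 else T a) = ∑ a ∈ u.filter (fun a => a ≠ 0), T a := by
      rw [Finset.sum_filter]
      refine Finset.sum_congr rfl fun a _ => ?_
      by_cases h : a = 0 <;> simp [h]
    rw [h1]
    exact hb _ fun a ha => (Finset.mem_filter.1 ha).2
  have hns : Summable (fun a => ‖(if a = 0 then 0 else Z a)‖) := by
    simp_rw [hn]
    refine summable_of_sum_le (c := B) (fun a => ?_) hle
    split_ifs
    · exact le_rfl
    · exact hT0 a
  refine (norm_tsum_le_tsum_norm hns).trans ?_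
  simp_rw [hn] at hns ⊢
  exact hns.tsum_le_of_sum_le hle

/-- Theorem: smooth lattice discrepancy upper bound. -/
theorem smooth_discrepancy_upper_lattice
    (d : ℕ) (hd : 1 ≤ d) (A : Matrix (Fin (d+1)) (Fin (d+1)) ℝ) (hdet : |A.det| = 1)
    (ℓ : ℕ) (w : Fin (d+1) → ℝ → ℝ) (hw : GoodWeights (d+1) ℓ w)
    (φ L : ℝ → ℝ) (ξ : ℝ)
    (hφmap : ∀ x, 1 ≤ x → 1 ≤ φ x)
    (hφmono : ∀ x y, 1 ≤ x → x ≤ y → φ x ≤ φ y)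
    (hbad : DualBad d A φ)
    (hbdd : Filter.IsBoundedUnder (· ≤ ·) Filter.atTop (fun x : ℝ => φ (2 * x) / φ x))
    (hξ : ξ = Filter.limsup (fun x : ℝ => φ (2 * x) / φ x) Filter.atTop)
    (hℓ : (ℓ : ℝ) > 2 + 2 * Real.log ξ / Real.log 2)
    (hLmap : ∀ x, φ 1 ≤ x → 1 ≤ L x)
    (hLdef : ∀ x, φ 1 ≤ x → L x * φ (L x) = x) :
    ∃ C : ℝ, 0 < C ∧ ∀ N : ℕ, φ 1 ≤ (N : ℝ) → ∀ γ ρ : Fin d → ℝ, IsBox ρ →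
      |DboxLat d A w γ ρ N| ≤ C * φ (L N) := by
  obtain ⟨m, C₁, rfl, hφ2⟩ := phi_growth φ ξ ℓ hφmap hφmono hbdd hξ hℓ
  have hwsupp : ∀ i x, w i x ≠ 0 → |x| ≤ 2 := fun i x hx => abs_le.2 ((hw i).2.1 hx)
  have hwcs : ∀ i, HasCompactSupport (w i) := fun i =>
    HasCompactSupport.intro (K := Set.Icc (-2:ℝ) 2) isCompact_Icc fun x hx => by
      by_contra h
      exact hx ((hw i).2.1 h)
  have hwcd : ∀ i, ContDiff ℝ ((m + 2 : ℕ) : WithTop ℕ∞) (w i) := fun i => (hw i).2.2.1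
  obtain ⟨K, hK, hKb⟩ := disc_bound d A hdet φ hφmap hφmono hbad m C₁ hφ2 w hwcd hwcs
  let b : ContDiffBump (0:ℝ) := ⟨2, 3, by norm_num, by norm_num⟩
  let w' : Fin (d+1) → ℝ → ℝ := fun _ => b
  obtain ⟨K', hK', hKb'⟩ := disc_bound d A hdet φ hφmap hφmono hbad m C₁ hφ2 w'
    (fun _ => b.contDiff) (fun _ => b.hasCompactSupport)
  have hMex : ∀ i, ∃ M : ℝ, 0 < M ∧ ∀ x, w i x ≤ M := by
    intro i
    obtain ⟨M, hM⟩ := (hwcs i).exists_bound_of_continuous (hwcd i).continuous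
    refine ⟨|M| + 1, by positivity, fun x => ?_⟩
    have := hM x
    rw [Real.norm_eq_abs] at this
    linarith [le_abs_self M, le_abs_self (w i x)]
  choose M hM hMw using hMex
  have hcpos : 0 ≤ smoothC w := Finset.prod_nonneg fun i _ => (hw i).2.2.2.2.le
  have hMpos : 0 < ∏ i, M i := Finset.prod_pos fun i _ => hM i
  refine ⟨K + (∏ i, M i) * (|smoothC w'| + K') + smoothC w, by positivity, ?_⟩
  intro N hN γ ρ hρ
  have hφ1 := hφmap 1 le_rfl
  have hNpos : (0:ℝ) < N := by linarith
  have hL1 := hLmap N hN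
  have hLN := hLdef N hN
  set Λ := L N with hΛ
  have hφL : 1 ≤ φ Λ := hφmap _ hL1
  set V := ∏ i, ρ i with hV
  have hVpos : 0 < V := Finset.prod_pos fun i _ => (hρ i).1
  let c : Fin (d+1) → ℝ := Fin.snoc γ 0
  have conv : ∀ ρ' : Fin d → ℝ, ∀ a, w (Fin.last d) (latPt A a (Fin.last d) / N) *
        ∏ i : Fin d, w i.castSucc ((latPt A a i.castSucc - γ i) / ρ' i) =
      ∏ i, w i ((latPt A a i - c i) / (Fin.snoc ρ' (N:ℝ) : Fin (d+1) → ℝ) i) := by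
    intro ρ' a
    rw [Fin.prod_univ_castSucc]
    simp [c, mul_comm]
  have hrpos : ∀ ρ' : Fin d → ℝ, (∀ i, 0 < ρ' i) →
      ∀ i, 0 < (Fin.snoc ρ' (N:ℝ) : Fin (d+1) → ℝ) i := by
    intro ρ' h i
    refine Fin.lastCases ?_ (fun j => ?_) i
    · simpa using hNpos
    · simpa using h j
  have hprod : ∀ ρ' : Fin d → ℝ, ∏ i, (Fin.snoc ρ' (N:ℝ) : Fin (d+1) → ℝ) i = (∏ i, ρ' i) * N := by
    intro ρ'
    rw [Fin.prod_univ_castSucc]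
    simp
  have hS := hKb c (Fin.snoc ρ (N:ℝ)) (hrpos ρ fun i => (hρ i).1)
    (fun i => by simp only [Fin.snoc_castSucc]; linarith [(hρ i).2])
  rw [hprod] at hS
  simp only [Fin.snoc_castSucc] at hS
  rw [DboxLat]
  simp_rw [conv ρ]
  rcases le_total (1 / V) Λ with hcase | hcase
  · have hV1 : 1 ≤ 1 / V := by
      rw [one_le_div hVpos]
      exact Finset.prod_le_one (fun i _ => (hρ i).1.le) fun i _ => by linarith [(hρ i).2]
    refine hS.2.trans ?_
    have h1 := hφmono _ _ hV1 hcase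
    have h2 : 0 ≤ (∏ i, M i) * (|smoothC w'| + K') + smoothC w := by positivity
    calc K * φ (1 / V) ≤ K * φ Λ := by gcongr
      _ ≤ _ := by nlinarith
  · -- small boxes: enlarge the box to volume `1 / Λ`
    obtain ⟨ρ', hρ'0, hρ'1, hρρ', hρ'V⟩ : ∃ ρ' : Fin d → ℝ, (∀ i, 0 < ρ' i) ∧ (∀ i, ρ' i ≤ 1) ∧
        (∀ i, ρ i ≤ ρ' i) ∧ ∏ i, ρ' i = 1 / Λ := by
      have hVlt : V < 1 := by
        have : V ≤ ∏ i : Fin d, (1/2 : ℝ) :=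
          Finset.prod_le_prod (fun i _ => (hρ i).1.le) fun i _ => (hρ i).2.le
        rw [Finset.prod_const, Finset.card_univ, Fintype.card_fin] at this
        exact this.trans_lt (pow_lt_one₀ (by norm_num) (by norm_num) (by omega))
      have hlogV : Real.log V < 0 := Real.log_neg hVpos hVlt
      have hlogL : 0 ≤ Real.log Λ := Real.log_nonneg hL1
      have hlogLV : Real.log Λ ≤ - Real.log V := by
        rw [← Real.log_inv, ← one_div]
        exact Real.log_le_log (by linarith) hcase
      let t := Real.log Λ / (-Real.log V)
      have ht0 : 0 ≤ t := div_nonneg hlogL (by linarith)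
      have ht1 : t ≤ 1 := by
        rw [div_le_one (by linarith)]; exact hlogLV
      refine ⟨fun i => ρ i ^ t, fun i => Real.rpow_pos_of_pos (hρ i).1 _,
        fun i => Real.rpow_le_one (hρ i).1.le (by linarith [(hρ i).2]) ht0, fun i => ?_, ?_⟩
      · calc ρ i = ρ i ^ (1:ℝ) := (Real.rpow_one _).symm
          _ ≤ ρ i ^ t := Real.rpow_le_rpow_of_exponent_ge (hρ i).1 (by linarith [(hρ i).2]) ht1
      · rw [Real.finset_prod_rpow _ _ (fun i _ => (hρ i).1.le), ← hV,
          Real.rpow_def_of_pos hVpos]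
        have : Real.log V * t = - Real.log Λ := by
          have hne : Real.log V ≠ 0 := hlogV.ne
          simp only [t]
          field_simp
        rw [this, Real.exp_neg, Real.exp_log (by linarith), one_div]
    have hS' := hKb' c (Fin.snoc ρ' (N:ℝ)) (hrpos ρ' hρ'0)
      (fun i => by simp only [Fin.snoc_castSucc]; exact hρ'1 i)
    rw [hprod] at hS'
    simp only [Fin.snoc_castSucc] at hS'
    rw [hρ'V, one_div_one_div] at hS'
    have hNΛ : 1 / Λ * N = φ Λ := by
      rw [← hLN]
      field_simp
    rw [hNΛ] at hS'
    set S := ∑' a, ∏ i, w i ((latPt A a i - c i) / (Fin.snoc ρ (N:ℝ) : Fin (d+1) → ℝ) i) with hSdef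
    set S' := ∑' a, ∏ i, w' i ((latPt A a i - c i) / (Fin.snoc ρ' (N:ℝ) : Fin (d+1) → ℝ) i)
      with hSdef'
    have hS0 : 0 ≤ S := tsum_nonneg fun a => Finset.prod_nonneg fun i _ => (hw i).1 _
    have hcmp : S ≤ (∏ i, M i) * S' := by
      rw [hSdef', ← tsum_mul_left]
      refine hS.1.tsum_le_tsum (fun a => ?_) (hS'.1.mul_left _)
      rw [← Finset.prod_mul_distrib]
      refine Finset.prod_le_prod (fun i _ => (hw i).1 _) fun i _ => ?_
      set y := latPt A a i - c i
      by_cases h0 : w i (y / (Fin.snoc ρ (N:ℝ) : Fin (d+1) → ℝ) i) = 0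
      · rw [h0]
        exact mul_nonneg (hM i).le b.nonneg
      · have h2 := hwsupp i _ h0
        have hle : (Fin.snoc ρ (N:ℝ) : Fin (d+1) → ℝ) i ≤ (Fin.snoc ρ' (N:ℝ) : Fin (d+1) → ℝ) i := by
          refine Fin.lastCases ?_ (fun j => ?_) i
          · simp
          · simpa using hρρ' j
        have p1 := hrpos ρ (fun i => (hρ i).1) i
        have p2 := hrpos ρ' hρ'0 i
        have h3 : |y / (Fin.snoc ρ' (N:ℝ) : Fin (d+1) → ℝ) i| ≤ 2 := by
          rw [abs_div, abs_of_pos p1, div_le_iff₀ p1] at h2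
          rw [abs_div, abs_of_pos p2, div_le_iff₀ p2]
          linarith
        have h4 : w' i (y / (Fin.snoc ρ' (N:ℝ) : Fin (d+1) → ℝ) i) = 1 := by
          refine b.one_of_mem_closedBall ?_
          rw [mem_closedBall_zero_iff, Real.norm_eq_abs]
          exact h3
        rw [h4, mul_one]
        exact hMw i _
    have hS'b : S' ≤ (|smoothC w'| + K') * φ Λ := by
      have h1 := (abs_le.1 hS'.2).2
      have h2 := mul_le_mul_of_nonneg_right (le_abs_self (smoothC w')) (by linarith : 0 ≤ φ Λ)
      linarith
    have hVN : V * N ≤ φ Λ := by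
      rw [← hNΛ]
      have : V ≤ 1 / Λ := by
        rw [le_div_iff₀ (by linarith)]
        rw [le_div_iff₀ hVpos] at hcase
        linarith
      gcongr
    have e1 : S ≤ (∏ i, M i) * ((|smoothC w'| + K') * φ Λ) :=
      hcmp.trans (mul_le_mul_of_nonneg_left hS'b hMpos.le)
    have e2 : smoothC w * (V * N) ≤ smoothC w * φ Λ := mul_le_mul_of_nonneg_left hVN hcpos
    have e3 : 0 ≤ smoothC w * (V * N) := by positivity
    have e4 : 0 ≤ K * φ Λ := by positivity
    have e5 : 0 ≤ (∏ i, M i) * ((|smoothC w'| + K') * φ Λ) := by positivity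
    rw [abs_le]
    constructor <;> nlinarith
end
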